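/- arXiv:2505.07025 — 6 statements merged into one kernel-verified Lean document; each statement's English description precedes it below -/
import Mathlib

section
/- Let r ≥ 2 and let H be an r-uniform hypergraph with h vertices, where h ≥ r. Then there is an absolute constant C such that for all n ≥ h, the local rainbow coloring number satisfies C_r(n,H) ≤ C · n^{(h-r)/h} · h^{2r + r/h}. (In particular, C_r(n,H) ≤ ⌈h^{2r + r/h} · n^{(h-r)/h}⌉ for all n ≥ h.) -/
open Finset

/-- A hypergraph on a finite set of natural-number vertices. -/
structure HGraph where
  verts : Finset ℕ
  edges : Finset (Finset ℕ)

/-- `H` is an `r`-uniform hypergraph. -/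
def HGraph.IsUniform (H : HGraph) (r : ℕ) : Prop :=
  ∀ e ∈ H.edges, e ⊆ H.verts ∧ e.card = r

/-- `φ` determines a copy of `H` in the complete hypergraph on vertex set `range n`. -/
def IsCopy (n : ℕ) (H : HGraph) (φ : ℕ → ℕ) : Prop :=
  Set.InjOn φ ↑H.verts ∧ ∀ v ∈ H.verts, φ v ∈ Finset.range n

/-- The family of edge-colourings `f v` with `k` colours is an `(n,r,H)`-local colouring:
for every copy of `H` there is a vertex of the copy whose colouring is rainbow on it. -/
def IsLocalColoring (n k : ℕ) (H : HGraph) (f : ℕ → Finset ℕ → Fin k) : Prop :=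
  ∀ φ : ℕ → ℕ, IsCopy n H φ →
    ∃ x ∈ H.verts, ∀ e₁ ∈ H.edges, ∀ e₂ ∈ H.edges,
      f (φ x) (e₁.image φ) = f (φ x) (e₂.image φ) → e₁ = e₂

/-- The local rainbow colouring number `C_r(n,H)`:
the least number of colours admitting an `(n,r,H)`-local colouring. -/
noncomputable def localC (n : ℕ) (H : HGraph) : ℕ :=
  sInf {k | ∃ f : ℕ → Finset ℕ → Fin k, IsLocalColoring n k H f}

/-- On a finite product space, events determined by disjoint sets of coordinates are
independent; only the upper bound is recorded. -/
theorem card_inter_mul_card_le {α β : Type*} [Fintype α] [DecidableEq α] [Fintype β]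
    [DecidableEq β] (s : Finset α) (A B : Finset (α → β))
    (hA : ∀ ω ω' : α → β, (∀ x ∈ s, ω x = ω' x) → ω ∈ A → ω' ∈ A)
    (hB : ∀ ω ω' : α → β, (∀ x ∉ s, ω x = ω' x) → ω ∈ B → ω' ∈ B) :
    #(A ∩ B) * Fintype.card (α → β) ≤ #A * #B := by
  rw [← Finset.card_univ, ← Finset.card_product, ← Finset.card_product]
  refine Finset.card_le_card_of_injOn
    (fun q => (fun x => if x ∈ s then q.1 x else q.2 x, fun x => if x ∈ s then q.2 x else q.1 x))
    ?_ ?_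
  · rintro ⟨ω, ω'⟩ hq
    simp only [coe_product, Set.mem_prod, mem_coe, mem_inter, mem_univ, and_true] at hq ⊢
    exact ⟨hA ω _ (fun x hx => by simp [hx]) hq.1, hB ω _ (fun x hx => by simp [hx]) hq.2⟩
  · rintro ⟨ω₁, ω₁'⟩ - ⟨ω₂, ω₂'⟩ - heq
    simp only [Prod.mk.injEq, funext_iff] at heq ⊢
    constructor <;> intro x <;> have h₁ := heq.1 x <;> have h₂ := heq.2 x <;>
      by_cases hx : x ∈ s <;> simp_all

/-- The outcomes avoiding all events `A j` with `j ∈ J`. -/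
def avoiding {Ω ι : Type*} [Fintype Ω] [DecidableEq Ω] (A : ι → Finset Ω) (J : Finset ι) :
    Finset Ω :=
  {ω | ∀ j ∈ J, ω ∉ A j}

theorem mem_avoiding {Ω ι : Type*} [Fintype Ω] [DecidableEq Ω] {A : ι → Finset Ω}
    {J : Finset ι} {ω : Ω} : ω ∈ avoiding A J ↔ ∀ j ∈ J, ω ∉ A j := by
  simp [avoiding]

section LocalLemma

variable {α β ι : Type*} [Fintype α] [DecidableEq α] [Fintype β] [DecidableEq β] [Nonempty β]
  {A : ι → Finset (α → β)} {s : ι → Finset α} {I : Finset ι} {a d : ℕ}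

/-- The inductive estimate of the local lemma: conditioned on avoiding any set of events, each
event has probability at most twice the a priori bound. -/
theorem card_inter_avoiding_mul_card_le
    (hA : ∀ i ∈ I, ∀ ω ω' : α → β, (∀ x ∈ s i, ω x = ω' x) → ω ∈ A i → ω' ∈ A i)
    (ha : ∀ i ∈ I, #(A i) ≤ a)
    (hd : ∀ i ∈ I, #{j ∈ I | ¬ Disjoint (s i) (s j)} ≤ d)
    (had : 4 * a * d ≤ Fintype.card (α → β)) (J : Finset ι) (hJ : J ⊆ I) {i : ι} (hi : i ∈ I) :
    #(A i ∩ avoiding A J) * Fintype.card (α → β) ≤ 2 * a * #(avoiding A J) := by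
  induction J using Finset.strongInduction generalizing i with
  | H J ih =>
    set N := Fintype.card (α → β) with hN
    have hNpos : 0 < N := Fintype.card_pos
    set D := {j ∈ J | ¬ Disjoint (s i) (s j)} with hD
    set J' := {j ∈ J | Disjoint (s i) (s j)} with hJ'
    have hJ'J : J' ⊆ J := filter_subset _ _
    have hdouble : #(avoiding A J') ≤ 2 * #(avoiding A J) := by
      rcases hJ'J.eq_or_ssubset with heq | hss
      · rw [heq]; omega
      · have hcover : avoiding A J' ⊆
            avoiding A J ∪ D.biUnion fun j => A j ∩ avoiding A J' := by
          intro ω hω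
          by_cases hω' : ω ∈ avoiding A J
          · exact mem_union_left _ hω'
          · simp only [mem_avoiding, not_forall, not_not] at hω'
            obtain ⟨j, hj, hωj⟩ := hω'
            refine mem_union_right _ (mem_biUnion.2 ⟨j, ?_, mem_inter.2 ⟨hωj, hω⟩⟩)
            refine mem_filter.2 ⟨hj, fun hdis => ?_⟩
            exact mem_avoiding.1 hω j (mem_filter.2 ⟨hj, hdis⟩) hωj
        have hDd : #D ≤ d := (card_le_card (filter_subset_filter _ hJ)).trans (hd i hi)
        have hsum : (∑ j ∈ D, #(A j ∩ avoiding A J')) * N ≤ d * (2 * a * #(avoiding A J')) := by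
          rw [sum_mul]
          refine (sum_le_card_nsmul D _ _ fun j hj => ?_).trans
            (Nat.mul_le_mul_right _ hDd)
          exact ih J' hss (hJ'J.trans hJ) (hJ (mem_filter.1 hj).1)
        have hcard : #(avoiding A J') ≤ #(avoiding A J) + ∑ j ∈ D, #(A j ∩ avoiding A J') :=
          (card_le_card hcover).trans ((card_union_le _ _).trans
            (Nat.add_le_add_left card_biUnion_le _))
        refine Nat.le_of_mul_le_mul_right ?_ hNpos
        nlinarith [Nat.mul_le_mul_right N hcard, Nat.mul_le_mul_right #(avoiding A J') had]
    have hind : #(A i ∩ avoiding A J') * N ≤ #(A i) * #(avoiding A J') := by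
      refine card_inter_mul_card_le (s i) _ _ (hA i hi) fun ω ω' hω hmem => ?_
      rw [mem_avoiding] at hmem ⊢
      intro j hj hω'
      obtain ⟨hjJ, hdis⟩ := mem_filter.1 hj
      refine hmem j hj (hA j (hJ hjJ) ω' ω (fun x hx => ?_) hω')
      exact (hω x (disjoint_right.1 hdis hx)).symm
    have hsub : A i ∩ avoiding A J ⊆ A i ∩ avoiding A J' :=
      inter_subset_inter_left fun ω hω =>
        mem_avoiding.2 fun j hj => mem_avoiding.1 hω j (hJ'J hj)
    calc #(A i ∩ avoiding A J) * N ≤ #(A i ∩ avoiding A J') * N :=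
          Nat.mul_le_mul_right _ (card_le_card hsub)
      _ ≤ #(A i) * #(avoiding A J') := hind
      _ ≤ a * (2 * #(avoiding A J)) := Nat.mul_le_mul (ha i hi) hdouble
      _ = 2 * a * #(avoiding A J) := by ring

/-- Symmetric Lovász local lemma for the uniform measure on a finite product space. -/
theorem avoiding_nonempty [DecidableEq ι]
    (hA : ∀ i ∈ I, ∀ ω ω' : α → β, (∀ x ∈ s i, ω x = ω' x) → ω ∈ A i → ω' ∈ A i)
    (ha : ∀ i ∈ I, #(A i) ≤ a)
    (hd : ∀ i ∈ I, #{j ∈ I | ¬ Disjoint (s i) (s j)} ≤ d) (hd0 : 0 < d)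
    (had : 4 * a * d ≤ Fintype.card (α → β)) : (avoiding A I).Nonempty := by
  suffices ∀ J ⊆ I, 0 < #(avoiding A J) from card_pos.1 (this I Subset.rfl)
  intro J
  induction J using Finset.induction_on with
  | empty =>
    intro _
    obtain ⟨b⟩ := ‹Nonempty β›
    exact card_pos.2 ⟨fun _ => b, mem_avoiding.2 (by simp)⟩
  | insert i J _ ih =>
    intro hJ
    obtain ⟨hi, hJ⟩ := insert_subset_iff.1 hJ
    have hpos := ih hJ
    have hest := card_inter_avoiding_mul_card_le hA ha hd had J hJ hi
    have hins : avoiding A (insert i J) = avoiding A J \ A i := by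
      ext ω
      simp [mem_avoiding, and_comm]
    rw [hins, card_sdiff]
    refine Nat.sub_pos_of_lt (lt_of_not_ge fun hle => ?_)
    have hNpos : 0 < Fintype.card (α → β) := Fintype.card_pos
    have hge : #(avoiding A J) * Fintype.card (α → β) ≤ 2 * a * #(avoiding A J) :=
      (Nat.mul_le_mul_right _ hle).trans hest
    have hN2 : Fintype.card (α → β) ≤ 2 * a :=
      Nat.le_of_mul_le_mul_right ((mul_comm _ _).trans_le hge) hpos
    nlinarith

end LocalLemma

section LocalColoring

variable {V : Type*} [Fintype V] [DecidableEq V]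

/-- The colourings `ω (u, ·)` of the `r`-subsets that are rainbow on `S` for no `u ∈ S`. -/
def badColorings (k r : ℕ) (S : Finset V) : Finset (V × Finset V → Fin k) :=
  {ω | ∀ u ∈ S, ∃ e ∈ S.powersetCard r, ∃ e' ∈ S.powersetCard r, e ≠ e' ∧ ω (u, e) = ω (u, e')}

theorem card_badColorings_mul_le (k r : ℕ) (S : Finset V) :
    #(badColorings k r S) * k ^ #S ≤
      ((#S).choose r ^ 2) ^ #S * Fintype.card (V × Finset V → Fin k) := by
  classical
  set P := S.powersetCard r ×ˢ S.powersetCard r with hP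
  have hPcard : Fintype.card (S → P) = ((#S).choose r ^ 2) ^ #S := by
    rw [Fintype.card_fun, Fintype.card_coe, Fintype.card_coe, hP, card_product,
      card_powersetCard, sq]
  have hScard : Fintype.card (S → Fin k) = k ^ #S := by simp
  rw [← hPcard, ← hScard, ← Fintype.card_prod, ← card_univ (α := S → Fin k), ← card_product,
    ← card_univ (α := (S → P) × _)]
  have hsel : ∀ ω ∈ badColorings k r S, ∃ g : S → P, ∀ u : S,
      (g u).1.1 ≠ (g u).1.2 ∧ ω (u, (g u).1.1) = ω (u, (g u).1.2) := by
    intro ω hω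
    have hω' : ∀ u : S, ∃ q : P, q.1.1 ≠ q.1.2 ∧ ω (u, q.1.1) = ω (u, q.1.2) := by
      intro u
      obtain ⟨e, he, e', he', hne, hcol⟩ := (mem_filter.1 hω).2 u u.2
      exact ⟨⟨(e, e'), mem_product.2 ⟨he, he'⟩⟩, hne, hcol⟩
    exact ⟨fun u => (hω' u).choose, fun u => (hω' u).choose_spec⟩
  rcases (badColorings k r S).eq_empty_or_nonempty with hempty | ⟨ω₀, hω₀⟩
  · simp [hempty]
  have : Nonempty (S → P) := ⟨(hsel ω₀ hω₀).choose⟩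
  choose! g hg using hsel
  refine card_le_card_of_injOn (fun q => (g q.1, fun x =>
    if hx : ∃ hu : x.1 ∈ S, x.2 = (g q.1 ⟨x.1, hu⟩).1.1 then q.2 ⟨x.1, hx.1⟩ else q.1 x))
    (fun _ _ => mem_univ _) ?_
  rintro ⟨ω₁, c₁⟩ h₁ ⟨ω₂, c₂⟩ h₂ heq
  simp only [coe_product, Set.mem_prod, mem_coe, mem_univ, and_true] at h₁ h₂
  simp only [Prod.mk.injEq] at heq
  obtain ⟨hgg, hfun⟩ := heq
  have hg₁ := hg ω₁ h₁
  have hg₂ := hg ω₂ h₂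
  rw [← hgg] at hg₂ hfun
  have hoff : ∀ x : V × Finset V, (¬ ∃ hu : x.1 ∈ S, x.2 = (g ω₁ ⟨x.1, hu⟩).1.1) →
      ω₁ x = ω₂ x := by
    intro x hx
    have := congrFun hfun x
    simpa only [dif_neg hx] using this
  have hω : ω₁ = ω₂ := by
    funext x
    by_cases hx : ∃ hu : x.1 ∈ S, x.2 = (g ω₁ ⟨x.1, hu⟩).1.1
    · obtain ⟨v, e⟩ := x
      obtain ⟨hu, he⟩ := hx
      change e = (g ω₁ ⟨v, hu⟩).1.1 at he
      rw [he, (hg₁ ⟨v, hu⟩).2, (hg₂ ⟨v, hu⟩).2]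
      exact hoff _ fun ⟨_, h'⟩ => (hg₁ ⟨v, hu⟩).1 h'.symm
    · exact hoff x hx
  have hc : c₁ = c₂ := by
    funext u
    have := congrFun hfun (u.1, (g ω₁ u).1.1)
    simpa using this
  rw [hω, hc]

theorem card_filter_not_disjoint_le (h r : ℕ) (S : Finset V) (hS : #S = h) :
    #{T ∈ (univ : Finset V).powersetCard h |
        ¬ Disjoint (S ×ˢ S.powersetCard r) (T ×ˢ T.powersetCard r)} ≤
      h.choose r * Fintype.card V ^ (h - r) := by
  have hsub : {T ∈ (univ : Finset V).powersetCard h |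
      ¬ Disjoint (S ×ˢ S.powersetCard r) (T ×ˢ T.powersetCard r)} ⊆
      (S.powersetCard r).biUnion fun e =>
        ((univ : Finset V).powersetCard (h - r)).image (e ∪ ·) := by
    intro T hT
    obtain ⟨hT, hdis⟩ := mem_filter.1 hT
    obtain ⟨⟨u, e⟩, he₁, he₂⟩ := not_disjoint_iff.1 hdis
    have he := (mem_product.1 he₁).2
    obtain ⟨heT, hecard⟩ := mem_powersetCard.1 (mem_product.1 he₂).2
    refine mem_biUnion.2 ⟨e, he, mem_image.2 ⟨T \ e, ?_, union_sdiff_of_subset heT⟩⟩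
    rw [mem_powersetCard, card_sdiff_of_subset heT, (mem_powersetCard.1 hT).2, hecard]
    exact ⟨subset_univ _, rfl⟩
  refine (card_le_card hsub).trans
    ((card_biUnion_le_card_mul _ _ (Fintype.card V ^ (h - r)) fun e _ =>
      card_image_le.trans ?_).trans_eq ?_)
  · rw [card_powersetCard, card_univ]
    exact Nat.choose_le_pow _ _
  · rw [card_powersetCard, hS]

/-- Local colourings of the complete `r`-graph for all `h`-cliques, under the local lemma
condition on the number of colours. -/
theorem exists_forall_exists_injOn_powersetCard {h r k : ℕ} (hrh : r ≤ h)
    (hV : 0 < Fintype.card V) (hk : 0 < k)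
    (hcond : 4 * (h.choose r ^ 2) ^ h * (h.choose r * Fintype.card V ^ (h - r)) ≤ k ^ h) :
    ∃ f : V → Finset V → Fin k, ∀ S : Finset V, #S = h →
      ∃ u ∈ S, Set.InjOn (f u) (S.powersetCard r : Set (Finset V)) := by
  have : Nonempty (Fin k) := ⟨⟨0, hk⟩⟩
  set N := Fintype.card (V × Finset V → Fin k) with hN
  set M := (h.choose r ^ 2) ^ h with hM
  set d := h.choose r * Fintype.card V ^ (h - r) with hd
  have hkh : 0 < k ^ h := pow_pos hk h
  suffices hne : (avoiding (badColorings (V := V) k r) (univ.powersetCard h)).Nonempty by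
    obtain ⟨ω, hω⟩ := hne
    refine ⟨fun u e => ω (u, e), fun S hS => ?_⟩
    have hgood := mem_avoiding.1 hω S (mem_powersetCard.2 ⟨subset_univ _, hS⟩)
    simp only [badColorings, mem_filter, mem_univ, true_and, not_forall] at hgood
    obtain ⟨u, hu, hinj⟩ := hgood
    refine ⟨u, hu, fun e he e' he' heq => ?_⟩
    by_contra hne
    exact hinj ⟨e, he, e', he', hne, heq⟩
  refine avoiding_nonempty (s := fun S => S ×ˢ S.powersetCard r) (a := M * N / k ^ h) (d := d)
    ?_ ?_ ?_ ?_ ?_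
  · intro S _ ω ω' heq hω
    refine mem_filter.2 ⟨mem_univ _, fun u hu => ?_⟩
    obtain ⟨e, he, e', he', hne, hcol⟩ := (mem_filter.1 hω).2 u hu
    refine ⟨e, he, e', he', hne, ?_⟩
    rw [← heq (u, e) (mem_product.2 ⟨hu, he⟩), ← heq (u, e') (mem_product.2 ⟨hu, he'⟩), hcol]
  · intro S hS
    have hScard := (mem_powersetCard.1 hS).2
    have := card_badColorings_mul_le k r S
    rw [hScard] at this
    exact (Nat.le_div_iff_mul_le hkh).2 this
  · intro S hS
    exact card_filter_not_disjoint_le h r S (mem_powersetCard.1 hS).2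
  · exact Nat.mul_pos (Nat.choose_pos hrh) (pow_pos hV _)
  · refine Nat.le_of_mul_le_mul_right ?_ hkh
    calc 4 * (M * N / k ^ h) * d * k ^ h = 4 * d * (M * N / k ^ h * k ^ h) := by ring
      _ ≤ 4 * d * (M * N) := Nat.mul_le_mul_left _ (Nat.div_mul_le_self _ _)
      _ = (4 * M * d) * N := by ring
      _ ≤ k ^ h * N := Nat.mul_le_mul_right _ hcond
      _ = N * k ^ h := mul_comm _ _

end LocalColoring

theorem localC_le_of_condition {n r k : ℕ} {H : HGraph} (hH : H.IsUniform r)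
    (hrh : r ≤ #H.verts) (hn : 0 < n) (hk : 0 < k)
    (hcond : 4 * ((#H.verts).choose r ^ 2) ^ #H.verts *
      ((#H.verts).choose r * n ^ (#H.verts - r)) ≤ k ^ #H.verts) :
    localC n H ≤ k := by
  obtain ⟨f, hf⟩ := exists_forall_exists_injOn_powersetCard (V := Fin n) hrh (by simpa) hk
    (by simpa using hcond)
  refine Nat.sInf_le ⟨fun v e => if hv : v < n then f ⟨v, hv⟩ {i | (i : ℕ) ∈ e} else ⟨0, hk⟩, ?_⟩
  rintro φ ⟨hinj, hrange⟩
  have hmap : ∀ e ⊆ H.verts,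
      ({i : Fin n | (i : ℕ) ∈ e.image φ} : Finset (Fin n)).map Fin.valEmbedding =
        e.image φ := by
    intro e he
    ext x
    simp only [mem_map, mem_filter, mem_univ, true_and, Fin.valEmbedding_apply]
    constructor
    · rintro ⟨i, hi, rfl⟩
      exact hi
    · intro hx
      obtain ⟨v, hv, rfl⟩ := mem_image.1 hx
      exact ⟨⟨φ v, mem_range.1 (hrange v (he hv))⟩, hx, rfl⟩
  have hcard : ∀ e ⊆ H.verts,
      #({i : Fin n | (i : ℕ) ∈ e.image φ} : Finset (Fin n)) = #e := by
    intro e he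
    rw [← card_map Fin.valEmbedding, hmap e he, card_image_of_injOn (hinj.mono he)]
  obtain ⟨u, hu, hrainbow⟩ := hf _ (hcard H.verts Subset.rfl)
  obtain ⟨x, hx, hxu⟩ := mem_image.1 (mem_filter.1 hu).2
  refine ⟨x, hx, fun e₁ he₁ e₂ he₂ heq => ?_⟩
  have hlt : φ x < n := mem_range.1 (hrange x hx)
  have hu' : (⟨φ x, hlt⟩ : Fin n) = u := Fin.ext hxu
  simp only [dif_pos hlt, hu'] at heq
  have hmem : ∀ e ∈ H.edges, ({i : Fin n | (i : ℕ) ∈ e.image φ} : Finset (Fin n)) ∈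
      powersetCard r ({i : Fin n | (i : ℕ) ∈ H.verts.image φ} : Finset (Fin n)) := by
    intro e he
    refine mem_powersetCard.2 ⟨fun i hi => ?_, (hcard e (hH e he).1).trans (hH e he).2⟩
    exact mem_filter.2 ⟨mem_univ _, image_subset_image (hH e he).1 (mem_filter.1 hi).2⟩
  have hpre := hrainbow (hmem e₁ he₁) (hmem e₂ he₂) heq
  have himage : e₁.image φ = e₂.image φ := by
    rw [← hmap e₁ (hH e₁ he₁).1, hpre, hmap e₂ (hH e₂ he₂).1]
  have hset : φ '' (e₁ : Set ℕ) = φ '' (e₂ : Set ℕ) := by exact_mod_cast himage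
  exact_mod_cast (hinj.image_eq_image_iff (hH e₁ he₁).1 (hH e₂ he₂).1).1 hset

theorem four_mul_choose_pow_mul_le {h r : ℕ} (hr : 2 ≤ r) (hrh : r ≤ h) :
    4 * (h.choose r ^ 2) ^ h * h.choose r ≤ h ^ (2 * r * h + r) := by
  have hc : h.choose r * 2 ≤ h ^ r := by
    calc h.choose r * 2 ≤ h.choose r * r.factorial :=
          Nat.mul_le_mul_left _ ((Nat.factorial_le hr).trans' (by decide))
      _ = h.descFactorial r := by rw [Nat.descFactorial_eq_factorial_mul_choose, mul_comm]
      _ ≤ h ^ r := Nat.descFactorial_le_pow _ _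
  have hh : h ≠ 0 := by omega
  calc 4 * (h.choose r ^ 2) ^ h * h.choose r
      ≤ 4 ^ h * (h.choose r ^ 2) ^ h * h.choose r := by
        gcongr
        exact Nat.le_self_pow hh 4
    _ = ((h.choose r * 2) ^ 2) ^ h * h.choose r := by
        rw [← mul_pow]
        ring
    _ ≤ ((h ^ r) ^ 2) ^ h * h ^ r := by
        gcongr
        omega
    _ = h ^ (2 * r * h + r) := by
        rw [← pow_mul, ← pow_mul, ← pow_add]
        ring_nf

theorem localC_le_ceil {n r : ℕ} (hr : 2 ≤ r) {H : HGraph} (hH : H.IsUniform r)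
    (hrh : r ≤ #H.verts) (hn : 0 < n) :
    localC n H ≤ ⌈(#H.verts : ℝ) ^ (2 * (r : ℝ) + (r : ℝ) / (#H.verts : ℝ)) *
      (n : ℝ) ^ (((#H.verts : ℝ) - (r : ℝ)) / (#H.verts : ℝ))⌉₊ := by
  set h := #H.verts with hh
  have hh0 : (0 : ℝ) < h := by exact_mod_cast (by omega : 0 < h)
  have hn0 : (0 : ℝ) < n := by exact_mod_cast hn
  set B := (h : ℝ) ^ (2 * (r : ℝ) + (r : ℝ) / (h : ℝ)) *
      (n : ℝ) ^ (((h : ℝ) - (r : ℝ)) / (h : ℝ)) with hB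
  have hB0 : 0 < B := by positivity
  have hpow : B ^ h = ((h ^ (2 * r * h + r) * n ^ (h - r) : ℕ) : ℝ) := by
    rw [hB, mul_pow, ← Real.rpow_mul_natCast hh0.le, ← Real.rpow_mul_natCast hn0.le,
      div_mul_cancel₀ _ hh0.ne', add_mul, div_mul_cancel₀ _ hh0.ne', ← Nat.cast_sub hrh,
      Real.rpow_natCast, Nat.cast_mul, Nat.cast_pow, Nat.cast_pow]
    congr 1
    exact_mod_cast Real.rpow_natCast (h : ℝ) (2 * r * h + r)
  refine localC_le_of_condition hH hrh hn (Nat.ceil_pos.2 hB0) ?_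
  have hle : h ^ (2 * r * h + r) * n ^ (h - r) ≤ ⌈B⌉₊ ^ h := by
    have : B ^ h ≤ (⌈B⌉₊ : ℝ) ^ h := pow_le_pow_left₀ hB0.le (Nat.le_ceil B) h
    rw [hpow] at this
    exact_mod_cast this
  refine le_trans ?_ hle
  rw [← mul_assoc]
  exact Nat.mul_le_mul_right _ (four_mul_choose_pow_mul_le hr hrh)

theorem stmt_0 (r : ℕ) (hr : 2 ≤ r) (H : HGraph) (hH : H.IsUniform r)
    (h : ℕ) (hh : h = H.verts.card) (hrh : r ≤ h) :
    (∃ C : ℝ, 0 < C ∧ ∀ n : ℕ, h ≤ n →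
      (localC n H : ℝ) ≤ C * (n : ℝ) ^ (((h : ℝ) - (r : ℝ)) / (h : ℝ)) *
        (h : ℝ) ^ (2 * (r : ℝ) + (r : ℝ) / (h : ℝ))) ∧
    (∀ n : ℕ, h ≤ n →
      localC n H ≤ ⌈(h : ℝ) ^ (2 * (r : ℝ) + (r : ℝ) / (h : ℝ)) *
        (n : ℝ) ^ (((h : ℝ) - (r : ℝ)) / (h : ℝ))⌉₊) := by
  subst hh
  have hceil : ∀ n : ℕ, #H.verts ≤ n → localC n H ≤
      ⌈(#H.verts : ℝ) ^ (2 * (r : ℝ) + (r : ℝ) / (#H.verts : ℝ)) *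
        (n : ℝ) ^ (((#H.verts : ℝ) - (r : ℝ)) / (#H.verts : ℝ))⌉₊ := fun n hn =>
    localC_le_ceil hr hH hrh (by omega)
  refine ⟨⟨2, two_pos, fun n hn => ?_⟩, hceil⟩
  have hh1 : (1 : ℝ) ≤ #H.verts := by exact_mod_cast (by omega : 1 ≤ #H.verts)
  have hn1 : (1 : ℝ) ≤ n := by exact_mod_cast (by omega : 1 ≤ n)
  have hrh' : (r : ℝ) ≤ #H.verts := by exact_mod_cast hrh
  have hge : 1 ≤ (#H.verts : ℝ) ^ (2 * (r : ℝ) + (r : ℝ) / (#H.verts : ℝ)) *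
      (n : ℝ) ^ (((#H.verts : ℝ) - (r : ℝ)) / (#H.verts : ℝ)) :=
    one_le_mul_of_one_le_of_one_le (Real.one_le_rpow hh1 (by positivity))
      (Real.one_le_rpow hn1 (div_nonneg (sub_nonneg.2 hrh') (by positivity)))
  have hlt := Nat.ceil_lt_add_one (zero_le_one.trans hge)
  have hle : (localC n H : ℝ) ≤ _ := Nat.cast_le.2 (hceil n hn)
  linarith
end

section
/- Let r ≥ 2 and let H be an r-uniform hypergraph. If H is not 2-locally large, then C_r(n,H) ≤ 2r+1 for every n. -/
open Finset

/-- The set `T_x^i` of edges of `H` determined by the labelling `σ`. -/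
def Txi (H : HGraph) (σ : ℕ → ℕ) (r x i : ℕ) : Finset (Finset ℕ) :=
  if i ≤ r then
    H.edges.filter fun e => x ∈ e ∧ (e.filter fun w => σ w < σ x).card = i - 1
  else
    H.edges.filter fun e => x ∉ e ∧ (e.filter fun w => σ w < σ x).card = i - r - 1

/-- `σ` witnesses that the `r`-graph `H` is 2-locally large. -/
def TwoLocallyLargeVia (r : ℕ) (H : HGraph) (σ : ℕ → ℕ) : Prop :=
  Set.BijOn σ ↑H.verts (Set.Icc 1 H.verts.card) ∧
  ∀ x ∈ H.verts, ∃ i ∈ Finset.Icc 1 (2 * r + 1), 2 ≤ (Txi H σ r x i).card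

/-- The `r`-graph `H` is 2-locally large. -/
def TwoLocallyLarge (r : ℕ) (H : HGraph) : Prop :=
  ∃ σ : ℕ → ℕ, TwoLocallyLargeVia r H σ

/-- The rank, starting from `1`, of `φ v` among the values of `φ` on `s`. -/
def rankOn (s : Finset ℕ) (φ : ℕ → ℕ) (v : ℕ) : ℕ :=
  (s.filter fun w => φ w ≤ φ v).card

lemma rankOn_lt_rankOn_iff {s : Finset ℕ} {φ : ℕ → ℕ} {w x : ℕ} (hx : x ∈ s) :
    rankOn s φ w < rankOn s φ x ↔ φ w < φ x := by
  constructor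
  · intro h
    by_contra! hle
    refine h.not_ge (card_le_card fun u hu => ?_)
    rw [mem_filter] at hu ⊢
    exact ⟨hu.1, hu.2.trans hle⟩
  · intro h
    refine card_lt_card (ssubset_iff_of_subset (fun u hu => ?_) |>.2 ⟨x, ?_, ?_⟩)
    · rw [mem_filter] at hu ⊢
      exact ⟨hu.1, hu.2.trans h.le⟩
    · simp [hx]
    · simp [h]

lemma bijOn_rankOn {s : Finset ℕ} {φ : ℕ → ℕ} (hφ : Set.InjOn φ ↑s) :
    Set.BijOn (rankOn s φ) ↑s (Set.Icc 1 s.card) := by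
  have hmaps : Set.MapsTo (rankOn s φ) ↑s ↑(Finset.Icc 1 s.card) := by
    intro v hv
    rw [mem_coe, Finset.mem_Icc]
    exact ⟨card_pos.2 ⟨v, mem_filter.2 ⟨hv, le_rfl⟩⟩, card_filter_le _ _⟩
  have hinj : Set.InjOn (rankOn s φ) ↑s := by
    intro v hv w hw h
    refine hφ hv hw (le_antisymm ?_ ?_)
    · exact not_lt.1 fun hlt => ((rankOn_lt_rankOn_iff hv).2 hlt).ne' h
    · exact not_lt.1 fun hlt => ((rankOn_lt_rankOn_iff hw).2 hlt).ne h
  rw [← Finset.coe_Icc]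
  exact ⟨hmaps, hinj, surjOn_of_injOn_of_card_le _ hmaps hinj (by simp)⟩

/-- The position of `v` relative to `e`: the number of smaller elements of `e`,
shifted by `r` when `v ∉ e`. -/
def position (r v : ℕ) (e : Finset ℕ) : ℕ :=
  if v ∈ e then (e.filter (· < v)).card else r + (e.filter (· < v)).card

lemma card_filter_lt_lt_card {v : ℕ} {e : Finset ℕ} (hv : v ∈ e) :
    (e.filter (· < v)).card < e.card :=
  card_lt_card (filter_ssubset.2 ⟨v, hv, lt_irrefl v⟩)

lemma position_lt {r v : ℕ} {e : Finset ℕ} (he : e.card = r) :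
    position r v e < 2 * r + 1 := by
  have h := card_filter_le e (· < v)
  unfold position
  split_ifs <;> omega

lemma mem_Txi_position {r x : ℕ} {H : HGraph} (hH : H.IsUniform r) {φ : ℕ → ℕ}
    (hφ : Set.InjOn φ ↑H.verts) (hx : x ∈ H.verts) {e : Finset ℕ} (he : e ∈ H.edges) :
    e ∈ Txi H (rankOn H.verts φ) r x (position r (φ x) (e.image φ) + 1) := by
  obtain ⟨hsub, hcard⟩ := hH e he
  have hinj : Set.InjOn φ ↑e := hφ.mono (coe_subset.2 hsub)
  have hmem : φ x ∈ e.image φ ↔ x ∈ e := by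
    refine ⟨fun h => ?_, mem_image_of_mem φ⟩
    obtain ⟨y, hy, hyx⟩ := mem_image.1 h
    exact hφ (hsub hy) hx hyx ▸ hy
  have hcount : ((e.image φ).filter (· < φ x)).card =
      (e.filter fun w => rankOn H.verts φ w < rankOn H.verts φ x).card := by
    simp only [rankOn_lt_rankOn_iff hx]
    rw [filter_image, card_image_of_injOn (hinj.mono (coe_subset.2 (filter_subset _ _)))]
  by_cases hxe : x ∈ e
  · have hlt := card_filter_lt_lt_card (hmem.2 hxe)
    rw [card_image_of_injOn hinj, hcard] at hlt
    rw [position, if_pos (hmem.2 hxe), Txi, if_pos (Nat.succ_le_of_lt hlt), mem_filter]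
    exact ⟨he, hxe, by omega⟩
  · rw [position, if_neg (mt hmem.1 hxe), Txi, if_neg (by omega), mem_filter]
    exact ⟨he, hxe, by omega⟩

theorem stmt_1 (r : ℕ) (hr : 2 ≤ r) (H : HGraph) (hH : H.IsUniform r)
    (hnot : ¬ TwoLocallyLarge r H) :
    ∀ n : ℕ, localC n H ≤ 2 * r + 1 := by
  intro n
  refine Nat.sInf_le ⟨fun v e => Fin.ofNat (2 * r + 1) (position r v e), ?_⟩
  rintro φ ⟨hφ, -⟩
  by_contra! hcon
  refine hnot ⟨rankOn H.verts φ, bijOn_rankOn hφ, fun x hx => ?_⟩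
  obtain ⟨e₁, he₁, e₂, he₂, heq, hne⟩ := hcon x hx
  have hlt : ∀ e ∈ H.edges, position r (φ x) (e.image φ) < 2 * r + 1 := fun e he =>
    position_lt ((card_image_of_injOn (hφ.mono (coe_subset.2 (hH e he).1))).trans (hH e he).2)
  have hpos : position r (φ x) (e₁.image φ) = position r (φ x) (e₂.image φ) := by
    simpa [Fin.ext_iff, Nat.mod_eq_of_lt (hlt e₁ he₁), Nat.mod_eq_of_lt (hlt e₂ he₂)] using heq
  refine ⟨position r (φ x) (e₁.image φ) + 1, ?_, one_lt_card.2 ⟨e₁, ?_, e₂, ?_, hne⟩⟩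
  · have := hlt e₁ he₁
    rw [Finset.mem_Icc]
    omega
  · exact mem_Txi_position hH hφ hx he₁
  · exact hpos ▸ mem_Txi_position hH hφ hx he₂
end

section
/- Let H be a 3-uniform hypergraph with exactly 3 edges such that the hypergraph obtained from H by deleting all isolated vertices is isomorphic to none of TP_3, SP_3 and LC_3. Then C_3(n,H) ≤ 7 for every n. -/
open Finset

/-- The tight path `TP₃` (vertices `a,b,c,d,e = 0,1,2,3,4`). -/
def TP3 : HGraph := ⟨{0, 1, 2, 3, 4}, {{0, 1, 2}, {1, 2, 3}, {2, 3, 4}}⟩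

/-- The special path `SP₃` (vertices `a,b,c,d,e,f = 0,1,2,3,4,5`). -/
def SP3 : HGraph := ⟨{0, 1, 2, 3, 4, 5}, {{0, 1, 2}, {1, 2, 3}, {3, 4, 5}}⟩

/-- The loose cycle `LC₃` (vertices `a,b,c,d,e,f = 0,1,2,3,4,5`). -/
def LC3 : HGraph := ⟨{0, 1, 2, 3, 4, 5}, {{0, 1, 3}, {1, 2, 4}, {0, 2, 5}}⟩

/-- The hypergraph obtained from `H` by deleting all isolated vertices. -/
def HGraph.core (H : HGraph) : HGraph :=
  ⟨H.verts.filter fun v => ∃ e ∈ H.edges, v ∈ e, H.edges⟩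

/-- `H₁` and `H₂` are isomorphic hypergraphs. -/
def Isomorphic (H₁ H₂ : HGraph) : Prop :=
  ∃ φ : ℕ → ℕ, Set.BijOn φ ↑H₁.verts ↑H₂.verts ∧
    H₁.edges.image (Finset.image φ) = H₂.edges

/-- The position of `v` relative to the set `e`. -/
def relPos (v : ℕ) (e : Finset ℕ) : ℕ := 2 * #{a ∈ e | v < a} + if v ∈ e then 1 else 0

lemma relPos_lt {v : ℕ} {e : Finset ℕ} (he : #e = 3) : relPos v e < 7 := by
  unfold relPos
  split_ifs with h
  · have : #{a ∈ e | v < a} < #e :=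
      card_lt_card (filter_ssubset.2 ⟨v, h, lt_irrefl v⟩)
    omega
  · have := card_filter_le e (v < ·)
    omega

lemma relPos_erase {m v : ℕ} (h : m < v) (e : Finset ℕ) : relPos v (e.erase m) = relPos v e := by
  have : {a ∈ e.erase m | v < a} = {a ∈ e | v < a} := by
    ext a
    simp only [mem_filter, mem_erase]
    constructor
    · tauto
    · intro ha
      exact ⟨⟨by omega, ha.1⟩, ha.2⟩
  simp [relPos, this, h.ne']

lemma relPos_of_le {m : ℕ} {e : Finset ℕ} (h : ∀ a ∈ e, m ≤ a) :
    relPos m e = 2 * #(e.erase m) + if m ∈ e then 1 else 0 := by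
  have : {a ∈ e | m < a} = e.erase m := by
    ext a
    simp only [mem_filter, mem_erase]
    constructor
    · intro ha
      exact ⟨by omega, ha.1⟩
    · intro ha
      exact ⟨ha.2, lt_of_le_of_ne (h a ha.2) (Ne.symm ha.1)⟩
  rw [relPos, this]

lemma card_eq_card_erase_add (m : ℕ) (e : Finset ℕ) :
    #e = #(e.erase m) + if m ∈ e then 1 else 0 := by
  split_ifs with h
  · exact (card_erase_add_one h).symm
  · rw [erase_eq_of_notMem h, add_zero]

/-- No vertex of `A ∪ B ∪ C` distinguishes the three sets by relative position. -/
def NoRainbow (A B C : Finset ℕ) : Prop :=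
  ∀ v ∈ A ∪ B ∪ C, relPos v A = relPos v B ∨ relPos v A = relPos v C ∨ relPos v B = relPos v C

/-- If no vertex is rainbow, then the number of vertices in at least two of the sets, which is
the sum of the pairwise intersection sizes minus twice the triple intersection size, is
the median of the cardinalities of the sets. -/
lemma NoRainbow.card_inter_eq_median {A B C : Finset ℕ} (hr : NoRainbow A B C) :
    #(A ∩ B) + #(A ∩ C) + #(B ∩ C) =
      2 * #(A ∩ B ∩ C) + max (min #A #B) (max (min #A #C) (min #B #C)) := by
  induction hn : #(A ∪ B ∪ C) generalizing A B C with
  | zero =>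
    have h : A ∪ B ∪ C = ∅ := card_eq_zero.1 hn
    simp only [union_eq_empty] at h
    obtain ⟨⟨rfl, rfl⟩, rfl⟩ := h
    simp
  | succ n ih =>
    have h : (A ∪ B ∪ C).Nonempty := card_pos.1 (by omega)
    obtain ⟨m, hmem, hle⟩ : ∃ m ∈ A ∪ B ∪ C, ∀ a ∈ A ∪ B ∪ C, m ≤ a :=
      ⟨_, min'_mem _ h, fun a ha => min'_le _ a ha⟩
    have hu : A.erase m ∪ B.erase m ∪ C.erase m = (A ∪ B ∪ C).erase m := by
      rw [erase_union_distrib, erase_union_distrib]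
    have hi : ∀ X Y : Finset ℕ, X.erase m ∩ Y.erase m = (X ∩ Y).erase m := fun X Y => by
      ext
      simp only [mem_inter, mem_erase]
      tauto
    have hr' : NoRainbow (A.erase m) (B.erase m) (C.erase m) := by
      intro v hv
      rw [hu] at hv
      have hlt : m < v :=
        lt_of_le_of_ne (hle v (mem_of_mem_erase hv)) (ne_of_mem_erase hv).symm
      simpa only [relPos_erase hlt] using hr v (mem_of_mem_erase hv)
    have key := ih hr' (by rw [hu, card_erase_of_mem hmem]; omega)
    have hc := hr m hmem
    rw [relPos_of_le fun a ha => hle a (by simp [ha]),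
      relPos_of_le (e := B) fun a ha => hle a (by simp [ha]),
      relPos_of_le (e := C) fun a ha => hle a (by simp [ha])] at hc
    simp only [hi] at key
    rw [card_eq_card_erase_add m (A ∩ B), card_eq_card_erase_add m (A ∩ C),
      card_eq_card_erase_add m (B ∩ C), card_eq_card_erase_add m (A ∩ B ∩ C),
      card_eq_card_erase_add m A, card_eq_card_erase_add m B, card_eq_card_erase_add m C]
    simp only [mem_inter]
    by_cases h1 : m ∈ A <;> by_cases h2 : m ∈ B <;> by_cases h3 : m ∈ C <;>
      simp only [h1, h2, h3, if_true, if_false, and_true, and_false] at hc ⊢ <;> omega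

/-- The sizes of the regions of the Venn diagram of three sets, in terms of intersection sizes. -/
lemma card_venn (A B C : Finset ℕ) :
    #((A ∩ B) \ C) + #(A ∩ B ∩ C) = #(A ∩ B) ∧ #((A ∩ C) \ B) + #(A ∩ B ∩ C) = #(A ∩ C) ∧
    #((B ∩ C) \ A) + #(A ∩ B ∩ C) = #(B ∩ C) ∧
    #((A \ B) \ C) + #(A ∩ B) + #((A ∩ C) \ B) = #A ∧
    #((B \ A) \ C) + #(A ∩ B) + #((B ∩ C) \ A) = #B ∧
    #((C \ A) \ B) + #(A ∩ C) + #((B ∩ C) \ A) = #C := by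
  have e1 : A ∩ C ∩ B = A ∩ B ∩ C := inter_right_comm A C B
  have e2 : B ∩ C ∩ A = A ∩ B ∩ C := by rw [inter_comm, inter_assoc]
  have e3 : (A \ B) ∩ C = (A ∩ C) \ B := by ext; simp; tauto
  have e4 : (B \ A) ∩ C = (B ∩ C) \ A := by ext; simp; tauto
  have e5 : (C \ A) ∩ B = (B ∩ C) \ A := by ext; simp; tauto
  have h1 := card_sdiff_add_card_inter (A ∩ B) C
  have h2 := card_sdiff_add_card_inter (A ∩ C) B
  have h3 := card_sdiff_add_card_inter (B ∩ C) A
  have h4 := card_sdiff_add_card_inter (A \ B) C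
  have h5 := card_sdiff_add_card_inter (B \ A) C
  have h6 := card_sdiff_add_card_inter (C \ A) B
  have h7 := card_sdiff_add_card_inter A B
  have h8 := card_sdiff_add_card_inter B A
  have h9 := card_sdiff_add_card_inter C A
  rw [inter_comm B A] at h8
  rw [inter_comm C A] at h9
  rw [e1] at h2
  rw [e2] at h3
  rw [e3] at h4
  rw [e4] at h5
  rw [e5] at h6
  omega

lemma HGraph.IsUniform.coe_core_verts {H : HGraph} {r : ℕ} (hH : H.IsUniform r) :
    (H.core.verts : Set ℕ) = {v | ∃ e ∈ H.edges, v ∈ e} := by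
  ext v
  simp only [HGraph.core, coe_filter, Set.mem_ofPred_eq, and_iff_right_iff_imp]
  rintro ⟨e, he, hv⟩
  exact (hH e he).1 hv

lemma exists_mem_iff_of_card_eq_one {s : Finset ℕ} (h : #s = 1) : ∃ a, ∀ v, v ∈ s ↔ v = a := by
  obtain ⟨a, rfl⟩ := card_eq_one.1 h
  exact ⟨a, fun v => mem_singleton⟩

lemma forall_not_mem_of_card_eq_zero {s : Finset ℕ} (h : #s = 0) : ∀ v, v ∉ s := by
  simp [card_eq_zero.1 h]

lemma isomorphic_core {H K : HGraph} {r : ℕ} (hH : H.IsUniform r) (φ : ℕ → ℕ)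
    (hφ : Set.InjOn φ {v | ∃ e ∈ H.edges, v ∈ e}) (hE : H.edges.image (image φ) = K.edges)
    (hK : ∀ v, v ∈ K.verts ↔ ∃ e ∈ K.edges, v ∈ e) : Isomorphic H.core K := by
  refine ⟨φ, ?_, hE⟩
  rw [hH.coe_core_verts]
  refine ⟨?_, hφ, ?_⟩
  · rintro v ⟨e, he, hv⟩
    rw [mem_coe, hK, ← hE]
    exact ⟨e.image φ, mem_image_of_mem _ he, mem_image_of_mem _ hv⟩
  · intro w hw
    rw [mem_coe, hK, ← hE] at hw
    obtain ⟨e', he', hw⟩ := hw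
    obtain ⟨e, he, rfl⟩ := mem_image.1 he'
    obtain ⟨v, hv, rfl⟩ := mem_image.1 hw
    exact ⟨v, ⟨e, he, hv⟩, rfl⟩

lemma exists_mem_iff_of_card_eq_two {s : Finset ℕ} (h : #s = 2) :
    ∃ a b, a ≠ b ∧ ∀ v, v ∈ s ↔ v = a ∨ v = b := by
  obtain ⟨a, b, hab, rfl⟩ := card_eq_two.1 h
  exact ⟨a, b, hab, fun v => by simp⟩

section

variable {H : HGraph} {A B C : Finset ℕ}

lemma isomorphic_TP3 (hH : H.IsUniform 3) (hE : H.edges = {A, B, C})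
    (hAB : #(A ∩ B) = 2) (hBC : #(B ∩ C) = 2) (hAC : #(A ∩ C) = 1) (ht : #(A ∩ B ∩ C) = 1) :
    Isomorphic H.core TP3 := by
  have hA := (hH A (by simp [hE])).2
  have hB := (hH B (by simp [hE])).2
  have hC := (hH C (by simp [hE])).2
  obtain ⟨_, _, _, _, _, _⟩ := card_venn A B C
  obtain ⟨a, rA⟩ := exists_mem_iff_of_card_eq_one (s := (A \ B) \ C) (by omega)
  have rB := forall_not_mem_of_card_eq_zero (s := (B \ A) \ C) (by omega)
  obtain ⟨e, rC⟩ := exists_mem_iff_of_card_eq_one (s := (C \ A) \ B) (by omega)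
  obtain ⟨b, rAB⟩ := exists_mem_iff_of_card_eq_one (s := (A ∩ B) \ C) (by omega)
  have rAC := forall_not_mem_of_card_eq_zero (s := (A ∩ C) \ B) (by omega)
  obtain ⟨d, rBC⟩ := exists_mem_iff_of_card_eq_one (s := (B ∩ C) \ A) (by omega)
  obtain ⟨c, rABC⟩ := exists_mem_iff_of_card_eq_one (s := A ∩ B ∩ C) (by omega)
  simp only [mem_sdiff, mem_inter] at rA rB rC rAB rAC rBC rABC
  have eA : A = {a, b, c} := by
    ext v
    simp only [mem_insert, mem_singleton]
    grind
  have eB : B = {b, c, d} := by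
    ext v
    simp only [mem_insert, mem_singleton]
    grind
  have eC : C = {c, d, e} := by
    ext v
    simp only [mem_insert, mem_singleton]
    grind
  have hab : a ≠ b := by grind
  have hac : a ≠ c := by grind
  have had : a ≠ d := by grind
  have hae : a ≠ e := by grind
  have hbc : b ≠ c := by grind
  have hbd : b ≠ d := by grind
  have hbe : b ≠ e := by grind
  have hcd : c ≠ d := by grind
  have hce : c ≠ e := by grind
  have hde : d ≠ e := by grind
  clear rA rB rC rAB rAC rBC rABC
  refine isomorphic_core hH
    (fun v => if v = a then 0 else if v = b then 1 else if v = c then 2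
      else if v = d then 3 else 4) ?_ ?_ ?_
  · rintro x ⟨s, hs, hx⟩ y ⟨t, ht, hy⟩ hxy
    have hx' : x = a ∨ x = b ∨ x = c ∨ x = d ∨ x = e := by
      simp only [hE, eA, eB, eC, mem_insert, mem_singleton] at hs
      rcases hs with rfl | rfl | rfl <;> simp only [mem_insert, mem_singleton] at hx <;>
        clear * - hx <;> tauto
    have hy' : y = a ∨ y = b ∨ y = c ∨ y = d ∨ y = e := by
      simp only [hE, eA, eB, eC, mem_insert, mem_singleton] at ht
      rcases ht with rfl | rfl | rfl <;> simp only [mem_insert, mem_singleton] at hy <;>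
        clear * - hy <;> tauto
    clear * - hx' hy' hxy hab hac had hae hbc hbd hbe hcd hce hde
    grind
  · rw [hE, eA, eB, eC]
    simp [TP3, image_insert, hab.symm, hac.symm, had.symm, hae.symm, hbc.symm, hbd.symm,
      hbe.symm, hcd.symm, hce.symm, hde.symm]
  · intro v
    simp [TP3]
    omega

lemma isomorphic_SP3 (hH : H.IsUniform 3) (hE : H.edges = {A, B, C})
    (hAB : #(A ∩ B) = 2) (hBC : #(B ∩ C) = 1) (hAC : #(A ∩ C) = 0) (ht : #(A ∩ B ∩ C) = 0) :
    Isomorphic H.core SP3 := by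
  have hA := (hH A (by simp [hE])).2
  have hB := (hH B (by simp [hE])).2
  have hC := (hH C (by simp [hE])).2
  obtain ⟨_, _, _, _, _, _⟩ := card_venn A B C
  obtain ⟨a, rA⟩ := exists_mem_iff_of_card_eq_one (s := (A \ B) \ C) (by omega)
  have rB := forall_not_mem_of_card_eq_zero (s := (B \ A) \ C) (by omega)
  obtain ⟨e, f, hef, rC⟩ :=
    exists_mem_iff_of_card_eq_two (s := (C \ A) \ B) (by omega)
  obtain ⟨b, c, hbc, rAB⟩ :=
    exists_mem_iff_of_card_eq_two (s := (A ∩ B) \ C) (by omega)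
  have rAC := forall_not_mem_of_card_eq_zero (s := (A ∩ C) \ B) (by omega)
  obtain ⟨d, rBC⟩ := exists_mem_iff_of_card_eq_one (s := (B ∩ C) \ A) (by omega)
  have rABC := forall_not_mem_of_card_eq_zero (s := A ∩ B ∩ C) (by omega)
  simp only [mem_sdiff, mem_inter] at rA rB rC rAB rAC rBC rABC
  have eA : A = {a, b, c} := by
    ext v
    simp only [mem_insert, mem_singleton]
    grind
  have eB : B = {b, c, d} := by
    ext v
    simp only [mem_insert, mem_singleton]
    grind
  have eC : C = {d, e, f} := by
    ext v
    simp only [mem_insert, mem_singleton]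
    grind
  have hab : a ≠ b := by grind
  have hac : a ≠ c := by grind
  have had : a ≠ d := by grind
  have hae : a ≠ e := by grind
  have haf : a ≠ f := by grind
  have hbd : b ≠ d := by grind
  have hbe : b ≠ e := by grind
  have hbf : b ≠ f := by grind
  have hcd : c ≠ d := by grind
  have hce : c ≠ e := by grind
  have hcf : c ≠ f := by grind
  have hde : d ≠ e := by grind
  have hdf : d ≠ f := by grind
  clear rA rB rC rAB rAC rBC rABC
  refine isomorphic_core hH
    (fun v => if v = a then 0 else if v = b then 1 else if v = c then 2
      else if v = d then 3 else if v = e then 4 else 5) ?_ ?_ ?_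
  · rintro x ⟨s, hs, hx⟩ y ⟨t, ht, hy⟩ hxy
    have hx' : x = a ∨ x = b ∨ x = c ∨ x = d ∨ x = e ∨ x = f := by
      simp only [hE, eA, eB, eC, mem_insert, mem_singleton] at hs
      rcases hs with rfl | rfl | rfl <;> simp only [mem_insert, mem_singleton] at hx <;>
        clear * - hx <;> tauto
    have hy' : y = a ∨ y = b ∨ y = c ∨ y = d ∨ y = e ∨ y = f := by
      simp only [hE, eA, eB, eC, mem_insert, mem_singleton] at ht
      rcases ht with rfl | rfl | rfl <;> simp only [mem_insert, mem_singleton] at hy <;>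
        clear * - hy <;> tauto
    clear * - hx' hy' hxy hab hac had hae haf hbc hbd hbe hbf hcd hce hcf hde hdf hef
    grind
  · rw [hE, eA, eB, eC]
    simp [SP3, image_insert, hab.symm, hac.symm, had.symm, hae.symm, haf.symm, hbc.symm,
      hbd.symm, hbe.symm, hbf.symm, hcd.symm, hce.symm, hcf.symm, hde.symm, hdf.symm, hef.symm]
  · intro v
    simp [SP3]
    omega

lemma isomorphic_LC3 (hH : H.IsUniform 3) (hE : H.edges = {A, B, C})
    (hAB : #(A ∩ B) = 1) (hBC : #(B ∩ C) = 1) (hAC : #(A ∩ C) = 1) (ht : #(A ∩ B ∩ C) = 0) :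
    Isomorphic H.core LC3 := by
  have hA := (hH A (by simp [hE])).2
  have hB := (hH B (by simp [hE])).2
  have hC := (hH C (by simp [hE])).2
  obtain ⟨_, _, _, _, _, _⟩ := card_venn A B C
  obtain ⟨d, rA⟩ := exists_mem_iff_of_card_eq_one (s := (A \ B) \ C) (by omega)
  obtain ⟨e, rB⟩ := exists_mem_iff_of_card_eq_one (s := (B \ A) \ C) (by omega)
  obtain ⟨f, rC⟩ := exists_mem_iff_of_card_eq_one (s := (C \ A) \ B) (by omega)
  obtain ⟨b, rAB⟩ := exists_mem_iff_of_card_eq_one (s := (A ∩ B) \ C) (by omega)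
  obtain ⟨a, rAC⟩ := exists_mem_iff_of_card_eq_one (s := (A ∩ C) \ B) (by omega)
  obtain ⟨c, rBC⟩ := exists_mem_iff_of_card_eq_one (s := (B ∩ C) \ A) (by omega)
  have rABC := forall_not_mem_of_card_eq_zero (s := A ∩ B ∩ C) (by omega)
  simp only [mem_sdiff, mem_inter] at rA rB rC rAB rAC rBC rABC
  have eA : A = {a, b, d} := by
    ext v
    simp only [mem_insert, mem_singleton]
    grind
  have eB : B = {b, c, e} := by
    ext v
    simp only [mem_insert, mem_singleton]
    grind
  have eC : C = {a, c, f} := by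
    ext v
    simp only [mem_insert, mem_singleton]
    grind
  have hab : a ≠ b := by grind
  have hac : a ≠ c := by grind
  have had : a ≠ d := by grind
  have hae : a ≠ e := by grind
  have haf : a ≠ f := by grind
  have hbc : b ≠ c := by grind
  have hbd : b ≠ d := by grind
  have hbe : b ≠ e := by grind
  have hbf : b ≠ f := by grind
  have hcd : c ≠ d := by grind
  have hce : c ≠ e := by grind
  have hcf : c ≠ f := by grind
  have hde : d ≠ e := by grind
  have hdf : d ≠ f := by grind
  have hef : e ≠ f := by grind
  clear rA rB rC rAB rAC rBC rABC
  refine isomorphic_core hH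
    (fun v => if v = a then 0 else if v = b then 1 else if v = c then 2
      else if v = d then 3 else if v = e then 4 else 5) ?_ ?_ ?_
  · rintro x ⟨s, hs, hx⟩ y ⟨t, ht, hy⟩ hxy
    have hx' : x = a ∨ x = b ∨ x = c ∨ x = d ∨ x = e ∨ x = f := by
      simp only [hE, eA, eB, eC, mem_insert, mem_singleton] at hs
      rcases hs with rfl | rfl | rfl <;> simp only [mem_insert, mem_singleton] at hx <;>
        clear * - hx <;> tauto
    have hy' : y = a ∨ y = b ∨ y = c ∨ y = d ∨ y = e ∨ y = f := by
      simp only [hE, eA, eB, eC, mem_insert, mem_singleton] at ht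
      rcases ht with rfl | rfl | rfl <;> simp only [mem_insert, mem_singleton] at hy <;>
        clear * - hy <;> tauto
    clear * - hx' hy' hxy hab hac had hae haf hbc hbd hbe hbf hcd hce hcf hde hdf hef
    grind
  · rw [hE, eA, eB, eC]
    simp [LC3, image_insert, hab.symm, hac.symm, had.symm, hae.symm, haf.symm, hbc.symm,
      hbd.symm, hbe.symm, hbf.symm, hcd.symm, hce.symm, hcf.symm, hde.symm, hdf.symm, hef.symm]
  · intro v
    simp [LC3]
    omega

end

/-- Local rainbow colouring by relative position. -/
def posColoring (v : ℕ) (e : Finset ℕ) : Fin 7 := Fin.ofNat 7 (relPos v e)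

lemma relPos_eq_of_posColoring_eq {v : ℕ} {e e' : Finset ℕ} (he : #e = 3) (he' : #e' = 3)
    (h : posColoring v e = posColoring v e') : relPos v e = relPos v e' := by
  have h' := congrArg Fin.val h
  simpa [posColoring, Nat.mod_eq_of_lt (relPos_lt he), Nat.mod_eq_of_lt (relPos_lt he')] using h'

lemma card_image_inter_image {φ : ℕ → ℕ} {V A B : Finset ℕ} (hφ : Set.InjOn φ V) (hA : A ⊆ V)
    (hB : B ⊆ V) : #(A.image φ ∩ B.image φ) = #(A ∩ B) := by
  have hsub : (↑(A ∪ B) : Set ℕ) ⊆ V := coe_subset.2 (union_subset hA hB)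
  rw [← image_inter_of_injOn A B (by rw [← coe_union]; exact hφ.mono hsub)]
  exact card_image_of_injOn (hφ.mono (coe_subset.2 (inter_subset_left.trans hA)))

lemma card_inter_le_two {A B : Finset ℕ} (hA : #A = 3) (hB : #B = 3) (h : A ≠ B) :
    #(A ∩ B) ≤ 2 := by
  by_contra! hlt
  have h1 : A ∩ B = A := eq_of_subset_of_card_le inter_subset_left (by omega)
  have h2 : A ∩ B = B := eq_of_subset_of_card_le inter_subset_right (by omega)
  exact h (h1.symm.trans h2)

lemma intersection_sizes_cases {x y z t : ℕ} (hx : x ≤ 2) (hy : y ≤ 2) (hz : z ≤ 2) (ht : t ≤ x)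
    (h : x + y + z = 2 * t + 3) :
    x = 2 ∧ y = 2 ∧ z = 1 ∧ t = 1 ∨ x = 2 ∧ y = 1 ∧ z = 2 ∧ t = 1 ∨
    x = 1 ∧ y = 2 ∧ z = 2 ∧ t = 1 ∨ x = 1 ∧ y = 1 ∧ z = 1 ∧ t = 0 ∨
    x = 2 ∧ y = 1 ∧ z = 0 ∧ t = 0 ∨ x = 2 ∧ y = 0 ∧ z = 1 ∧ t = 0 ∨
    x = 1 ∧ y = 2 ∧ z = 0 ∧ t = 0 ∨ x = 1 ∧ y = 0 ∧ z = 2 ∧ t = 0 ∨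
    x = 0 ∧ y = 1 ∧ z = 2 ∧ t = 0 ∨ x = 0 ∧ y = 2 ∧ z = 1 ∧ t = 0 := by
  interval_cases x <;> interval_cases y <;> interval_cases z <;> simp <;> omega

lemma isLocalColoring_posColoring {H : HGraph} (hH : H.IsUniform 3) (hcard : #H.edges = 3)
    (h1 : ¬ Isomorphic H.core TP3) (h2 : ¬ Isomorphic H.core SP3)
    (h3 : ¬ Isomorphic H.core LC3) (n : ℕ) : IsLocalColoring n 7 H posColoring := by
  rintro φ ⟨hφ, -⟩
  obtain ⟨A, B, C, hAB, hAC, hBC, hE⟩ := card_eq_three.1 hcard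
  obtain ⟨hAV, hA⟩ := hH A (by simp [hE])
  obtain ⟨hBV, hB⟩ := hH B (by simp [hE])
  obtain ⟨hCV, hC⟩ := hH C (by simp [hE])
  have card_im : ∀ {e : Finset ℕ}, e ⊆ H.verts → #e = 3 → #(e.image φ) = 3 := fun he h => by
    rw [card_image_of_injOn (hφ.mono (coe_subset.2 he)), h]
  by_contra! hcon
  have hbad : NoRainbow (A.image φ) (B.image φ) (C.image φ) := by
    intro w hw
    obtain ⟨x, hx, rfl⟩ : ∃ x ∈ H.verts, φ x = w := by
      simp only [mem_union, mem_image] at hw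
      rcases hw with (⟨x, hx, rfl⟩ | ⟨x, hx, rfl⟩) | ⟨x, hx, rfl⟩
      exacts [⟨x, hAV hx, rfl⟩, ⟨x, hBV hx, rfl⟩, ⟨x, hCV hx, rfl⟩]
    obtain ⟨e₁, he₁, e₂, he₂, heq, hne⟩ := hcon x hx
    have key := relPos_eq_of_posColoring_eq (card_im (hH e₁ he₁).1 (hH e₁ he₁).2)
      (card_im (hH e₂ he₂).1 (hH e₂ he₂).2) heq
    simp only [hE, mem_insert, mem_singleton] at he₁ he₂
    rcases he₁ with rfl | rfl | rfl <;> rcases he₂ with rfl | rfl | rfl <;>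
      first | exact absurd rfl hne | simp [key]
  have hmed := hbad.card_inter_eq_median
  rw [card_im hAV hA, card_im hBV hB, card_im hCV hC] at hmed
  simp only [min_self, max_self] at hmed
  have hABC : #(A.image φ ∩ B.image φ ∩ C.image φ) = #(A ∩ B ∩ C) := by
    rw [← card_image_inter_image hφ (inter_subset_left.trans hAV) hCV, image_inter_of_injOn A B]
    rw [← coe_union]
    exact hφ.mono (coe_subset.2 (union_subset hAV hBV))
  rw [card_image_inter_image hφ hAV hBV, card_image_inter_image hφ hAV hCV,
    card_image_inter_image hφ hBV hCV, hABC] at hmed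
  have eACB : H.edges = {A, C, B} := by rw [hE, pair_comm]
  have eBAC : H.edges = {B, A, C} := by rw [hE, insert_comm]
  have eBCA : H.edges = {B, C, A} := by rw [eBAC, pair_comm]
  have eCAB : H.edges = {C, A, B} := by rw [eACB, insert_comm]
  have eCBA : H.edges = {C, B, A} := by rw [eCAB, pair_comm]
  have t1 : #(A ∩ C ∩ B) = #(A ∩ B ∩ C) := congrArg card <| inter_right_comm A C B
  have t2 : #(B ∩ A ∩ C) = #(A ∩ B ∩ C) := by rw [inter_comm B A]
  have t3 : #(B ∩ C ∩ A) = #(A ∩ B ∩ C) := by rw [inter_comm, inter_assoc]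
  have t4 : #(C ∩ A ∩ B) = #(A ∩ B ∩ C) := by rw [inter_comm C A, t1]
  have t5 : #(C ∩ B ∩ A) = #(A ∩ B ∩ C) := by rw [inter_comm C B, t3]
  have cBA := congrArg card (inter_comm B A)
  have cCA := congrArg card (inter_comm C A)
  have cCB := congrArg card (inter_comm C B)
  rcases intersection_sizes_cases (card_inter_le_two hA hB hAB) (card_inter_le_two hA hC hAC)
    (card_inter_le_two hB hC hBC) (card_le_card inter_subset_left) hmed with
    h | h | h | h | h | h | h | h | h | h <;> obtain ⟨hx, hy, hz, ht⟩ := h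
  · exact h1 (isomorphic_TP3 hH eBAC (by omega) (by omega) (by omega) (by omega))
  · exact h1 (isomorphic_TP3 hH hE (by omega) (by omega) (by omega) (by omega))
  · exact h1 (isomorphic_TP3 hH eACB (by omega) (by omega) (by omega) (by omega))
  · exact h3 (isomorphic_LC3 hH hE (by omega) (by omega) (by omega) (by omega))
  · exact h2 (isomorphic_SP3 hH eBAC (by omega) (by omega) (by omega) (by omega))
  · exact h2 (isomorphic_SP3 hH hE (by omega) (by omega) (by omega) (by omega))
  · exact h2 (isomorphic_SP3 hH eCAB (by omega) (by omega) (by omega) (by omega))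
  · exact h2 (isomorphic_SP3 hH eCBA (by omega) (by omega) (by omega) (by omega))
  · exact h2 (isomorphic_SP3 hH eBCA (by omega) (by omega) (by omega) (by omega))
  · exact h2 (isomorphic_SP3 hH eACB (by omega) (by omega) (by omega) (by omega))

theorem stmt_7 (H : HGraph) (hH : H.IsUniform 3) (hcard : H.edges.card = 3)
    (h1 : ¬ Isomorphic H.core TP3) (h2 : ¬ Isomorphic H.core SP3)
    (h3 : ¬ Isomorphic H.core LC3) :
    ∀ n : ℕ, localC n H ≤ 7 := by
  exact fun n => Nat.sInf_le ⟨posColoring, isLocalColoring_posColoring hH hcard h1 h2 h3 n⟩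
end

section
/- Let H be a 3-uniform hypergraph with at least 3 edges such that either H has at least 4 edges, or H has exactly 3 edges and the hypergraph obtained from H by deleting all isolated vertices is isomorphic to one of TP_3, SP_3 and LC_3. Then there exist a constant c = c(H) > 0 and an n_0 such that for all n ≥ n_0, C_3(n,H) ≥ c · (log^{(3)}(n) / log^{(4)}(n))^{1/16}, where log^{(j)}(n) denotes the j-fold iterated logarithm of n. -/
open Finset

/-- The `j`-fold iterated logarithm. -/
noncomputable def iterLog : ℕ → ℝ → ℝ
  | 0, x => x
  | j + 1, x => Real.log (iterLog j x)

/-! ### Rearranging the columns of a `0/1`-matrix with four rows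

A column is encoded by a natural number whose `i`-th bit is its entry in row `i`. -/

/-- Two coordinates have equal heights in `x` and equal bits in the column `c`. -/
def ties (x : Fin 4 → ℕ) (c : ℕ) : Bool :=
  let t (i j : Fin 4) : Bool := Nat.beq (x i) (x j) && (c.testBit i == c.testBit j)
  t 0 1 || t 0 2 || t 0 3 || t 1 2 || t 1 3 || t 2 3

theorem exists_of_ties {x : Fin 4 → ℕ} {c : ℕ} (h : ties x c = true) :
    ∃ i j : Fin 4, i ≠ j ∧ x i = x j ∧ c.testBit i = c.testBit j := by
  simp only [ties, Bool.or_eq_true, Bool.and_eq_true, beq_iff_eq, Nat.beq_eq] at h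
  rcases h with ((((h | h) | h) | h) | h) | h <;> exact ⟨_, _, by decide, h⟩

/-- The column `c` is at most `b` in every coordinate. -/
def fits (c : ℕ) (b : Fin 4 → ℕ) : Bool :=
  let t (i : Fin 4) : Bool := Nat.ble (c.testBit i).toNat (b i)
  t 0 && t 1 && t 2 && t 3

theorem fits_of_forall {c : ℕ} {b : Fin 4 → ℕ} (h : ∀ i : Fin 4, (c.testBit i).toNat ≤ b i) :
    fits c b = true := by
  simp only [fits, Bool.and_eq_true, Nat.ble_eq]
  exact ⟨⟨⟨h 0, h 1⟩, h 2⟩, h 3⟩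

/-- All coordinates of `b` vanish. -/
def vanishes (b : Fin 4 → ℕ) : Bool :=
  Nat.beq (b 0) 0 && Nat.beq (b 1) 0 && Nat.beq (b 2) 0 && Nat.beq (b 3) 0

/-- Add the column `c` to the heights `x`. -/
def addColumn (x : Fin 4 → ℕ) (c : ℕ) : Fin 4 → ℕ := fun i => x i + (c.testBit i).toNat

/-- Reading the columns of `L` one after the other, starting from heights `x`, there is always
a tie. -/
def TiesAlong : (Fin 4 → ℕ) → List ℕ → Prop
  | _, [] => True
  | x, c :: L => ties x c = true ∧ TiesAlong (addColumn x c) L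

/-- Depth-first search for a rearrangement of `L` along which there is always a tie. -/
def searchTies : ℕ → (Fin 4 → ℕ) → List ℕ → Bool
  | 0, _, L => L.isEmpty
  | d + 1, x, L =>
    L.isEmpty || L.any fun c => ties x c && searchTies d (addColumn x c) (L.erase c)

theorem exists_perm_of_searchTies (d : ℕ) (x : Fin 4 → ℕ) (L : List ℕ)
    (h : searchTies d x L = true) : ∃ L', L'.Perm L ∧ TiesAlong x L' := by
  induction d generalizing x L with
  | zero =>
    simp only [searchTies, List.isEmpty_iff] at h
    exact ⟨[], by simp [h], trivial⟩
  | succ d ih =>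
    simp only [searchTies, Bool.or_eq_true, List.isEmpty_iff, List.any_eq_true,
      Bool.and_eq_true] at h
    rcases h with h | ⟨c, hc, hx, hs⟩
    · exact ⟨[], by simp [h], trivial⟩
    · obtain ⟨L', hL, hT⟩ := ih _ _ hs
      exact ⟨c :: L', (hL.cons c).trans (List.perm_cons_erase hc).symm, hx, hT⟩

/-- Run `searchTies` on `L ++ A` for all lists `L` of columns from `C` with row sums `b`, up to
rearrangement. -/
def checkColumns : ℕ → List ℕ → List ℕ → (Fin 4 → ℕ) → Bool
  | 0, _, _, _ => false
  | _ + 1, [], A, b => !vanishes b || searchTies 12 (fun _ => 0) A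
  | d + 1, c :: C, A, b => checkColumns d C A b &&
      (!fits c b || checkColumns d (c :: C) (c :: A) fun i => b i - (c.testBit i).toNat)

theorem exists_perm_of_checkColumns (d : ℕ) (C A : List ℕ) (b : Fin 4 → ℕ) (L : List ℕ)
    (hd : C.length + L.length < d) (hL : ∀ c ∈ L, c ∈ C)
    (hb : ∀ i : Fin 4, L.countP (fun c => c.testBit i) = b i)
    (h : checkColumns d C A b = true) :
    ∃ L', L'.Perm (L ++ A) ∧ TiesAlong (fun _ => 0) L' := by
  induction d generalizing C A b L with
  | zero => omega
  | succ d ih =>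
    match C with
    | [] =>
      obtain rfl : L = [] := List.eq_nil_iff_forall_not_mem.2 fun c hc => by simpa using hL c hc
      have hb' : vanishes b = true := by simp [vanishes, ← hb]
      simp only [checkColumns, hb', Bool.not_true, Bool.false_or] at h
      exact exists_perm_of_searchTies _ _ _ h
    | c :: C =>
      simp only [checkColumns, Bool.and_eq_true, Bool.or_eq_true, Bool.not_eq_true'] at h
      simp only [List.length_cons] at hd
      by_cases hc : c ∈ L
      · have hp := List.perm_cons_erase hc
        have hcount : ∀ i : Fin 4, b i = (L.erase c).countP (fun c => c.testBit i) +
            (c.testBit i).toNat := fun i => by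
          rw [← hb i, hp.countP_eq, List.countP_cons]; cases c.testBit i <;> simp
        have hlen := hp.length_eq
        simp only [List.length_cons] at hlen
        have hfits : fits c b = true := fits_of_forall fun i => by simp [hcount i]
        obtain ⟨L', hL', hT⟩ := ih (c :: C) (c :: A) (fun i => b i - (c.testBit i).toNat)
          (L.erase c) (by simp only [List.length_cons]; omega) (fun a ha => hL a (List.mem_of_mem_erase ha))
          (fun i => by simp [hcount i]) (h.2.resolve_left (by simp [hfits]))
        exact ⟨L', hL'.trans (List.perm_middle.trans (hp.symm.append_right A)), hT⟩
      · exact ih C A b L (by omega) (fun a ha => (List.mem_cons.1 (hL a ha)).resolve_left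
          fun e => hc (e ▸ ha)) hb h.1

theorem checkColumns_three :
    checkColumns 28 [15, 14, 13, 11, 7, 12, 10, 9, 6, 5, 3, 8, 4, 2, 1] [] (fun _ => 3) = true := by
  decide +kernel

/-- The nonzero columns of a `0/1`-matrix with four rows, all with row sum three, can be
rearranged so that there is always a tie. -/
theorem exists_perm_tiesAlong (L : List ℕ) (hlen : L.length ≤ 12)
    (hL : ∀ c ∈ L, c ≠ 0 ∧ c < 16)
    (hb : ∀ i : Fin 4, L.countP (fun c => c.testBit i) = 3) :
    ∃ L', L'.Perm L ∧ TiesAlong (fun _ => 0) L' := by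
  have := exists_perm_of_checkColumns _ _ _ _ L (by simp; omega) (fun c hc => ?_) hb
    checkColumns_three
  · simpa using this
  · have := hL c hc
    simp only [List.mem_cons, List.not_mem_nil, or_false]
    omega

/-! ### Orderings of a hypergraph -/

/-- The hypergraph `H` has a vertex ordering in which every vertex has the same position relative to
two distinct edges. -/
def HGraph.Orderable (H : HGraph) : Prop :=
  ∃ ρ : ℕ → ℕ, Set.InjOn ρ ↑H.verts ∧ ∀ u ∈ H.verts, ∃ e₁ ∈ H.edges, ∃ e₂ ∈ H.edges, e₁ ≠ e₂ ∧
    (u ∈ e₁ ↔ u ∈ e₂) ∧ (e₁.filter (ρ · < ρ u)).card = (e₂.filter (ρ · < ρ u)).card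

theorem orderable_TP3 : TP3.Orderable :=
  ⟨fun v => [0, 2, 3, 1, 4].getD v 0, by
    simp only [Set.InjOn, mem_coe]; decide, by decide⟩

theorem orderable_SP3 : SP3.Orderable :=
  ⟨fun v => [0, 2, 3, 1, 4, 5].getD v 0, by
    simp only [Set.InjOn, mem_coe]; decide, by decide⟩

theorem orderable_LC3 : LC3.Orderable :=
  ⟨fun v => [0, 2, 4, 5, 1, 3].getD v 0, by
    simp only [Set.InjOn, mem_coe]; decide, by decide⟩

theorem HGraph.Orderable.of_isomorphic {H K : HGraph} (hH : ∀ e ∈ H.edges, e ⊆ H.verts)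
    (hHK : Isomorphic H K) (hK : K.Orderable) : H.Orderable := by
  obtain ⟨φ, hφ, hE⟩ := hHK
  obtain ⟨ρ, hρ, hρE⟩ := hK
  refine ⟨ρ ∘ φ, hρ.comp hφ.injOn hφ.mapsTo, fun u hu => ?_⟩
  obtain ⟨e₁, h₁, e₂, h₂, hne, hmem, hcard⟩ := hρE (φ u) (hφ.mapsTo hu)
  rw [← hE, Finset.mem_image] at h₁ h₂
  obtain ⟨d₁, hd₁, rfl⟩ := h₁
  obtain ⟨d₂, hd₂, rfl⟩ := h₂
  have hcount : ∀ d ∈ H.edges, ((d.image φ).filter (ρ · < ρ (φ u))).card =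
      (d.filter ((ρ ∘ φ) · < (ρ ∘ φ) u)).card := fun d hd => by
    rw [filter_image, card_image_of_injOn]
    · rfl
    · exact hφ.injOn.mono fun x hx => hH d hd (mem_filter.1 hx).1
  have hmem' : ∀ d ∈ H.edges, φ u ∈ d.image φ ↔ u ∈ d := fun d hd => by
    refine ⟨fun h => ?_, mem_image_of_mem φ⟩
    obtain ⟨x, hx, hxu⟩ := mem_image.1 h
    rwa [← hφ.injOn (hH d hd hx) hu hxu]
  rw [hmem' _ hd₁, hmem' _ hd₂] at hmem
  rw [hcount _ hd₁, hcount _ hd₂] at hcard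
  exact ⟨d₁, hd₁, d₂, hd₂, fun h => hne (h ▸ rfl), hmem, hcard⟩

theorem HGraph.mem_core_verts {H : HGraph} {v : ℕ} :
    v ∈ H.core.verts ↔ v ∈ H.verts ∧ ∃ e ∈ H.edges, v ∈ e := by
  simp [HGraph.core]

/-- Isolated vertices can be put in front of all others. -/
theorem HGraph.Orderable.of_core {H : HGraph} (hH : ∀ e ∈ H.edges, e ⊆ H.verts)
    (hcard : 2 ≤ H.edges.card) (hcore : H.core.Orderable) : H.Orderable := by
  classical
  obtain ⟨ρ, hρ, hρE⟩ := hcore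
  set s := H.verts.sup id + 1
  have hs : ∀ v ∈ H.verts, v < s := fun v hv => Nat.lt_succ_of_le (le_sup (f := id) hv)
  have hmem : ∀ e ∈ H.edges, ∀ v ∈ e, v ∈ H.core.verts := fun e he v hv =>
    HGraph.mem_core_verts.2 ⟨hH e he hv, e, he, hv⟩
  refine ⟨fun v => if v ∈ H.core.verts then s + ρ v else v, fun v hv w hw hvw => ?_,
    fun u hu => ?_⟩
  · have := hs v hv
    have := hs w hw
    dsimp only at hvw
    split_ifs at hvw with h₁ h₂ h₂
    · exact hρ h₁ h₂ (by omega)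
    · omega
    · omega
    · exact hvw
  · by_cases huc : u ∈ H.core.verts
    · obtain ⟨e₁, h₁, e₂, h₂, hne, hiff, hc⟩ := hρE u huc
      refine ⟨e₁, h₁, e₂, h₂, hne, hiff, ?_⟩
      have key : ∀ e ∈ H.edges, e.filter (fun v => (if v ∈ H.core.verts then s + ρ v else v) <
          if u ∈ H.core.verts then s + ρ u else u) = e.filter (ρ · < ρ u) := fun e he =>
        filter_congr fun v hv => by simp [hmem e he v hv, huc]
      rw [key e₁ h₁, key e₂ h₂, hc]
    · obtain ⟨e₁, h₁, e₂, h₂, hne⟩ := one_lt_card.1 hcard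
      have hnot : ∀ e ∈ H.edges, u ∉ e := fun e he hu => huc (hmem e he u hu)
      refine ⟨e₁, h₁, e₂, h₂, hne, by simp [hnot _ h₁, hnot _ h₂], ?_⟩
      have key : ∀ e ∈ H.edges, e.filter (fun v => (if v ∈ H.core.verts then s + ρ v else v) <
          if u ∈ H.core.verts then s + ρ u else u) = ∅ := fun e he =>
        filter_eq_empty_iff.2 fun v hv => by
          have := hs u hu
          simp only [hmem e he v hv, huc, if_true, if_false]
          omega
      rw [key e₁ h₁, key e₂ h₂]

theorem HGraph.Orderable.mono {H K : HGraph} (hV : K.verts = H.verts) (hE : K.edges ⊆ H.edges)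
    (hK : K.Orderable) : H.Orderable := by
  obtain ⟨ρ, hρ, h⟩ := hK
  refine ⟨ρ, hV ▸ hρ, fun u hu => ?_⟩
  obtain ⟨e₁, h₁, e₂, h₂, hh⟩ := h u (hV ▸ hu)
  exact ⟨e₁, hE h₁, e₂, hE h₂, hh⟩

/-- The column of the vertex `v` in the incidence matrix of the four edges `e`. -/
def column (e : Fin 4 → Finset ℕ) (v : ℕ) : ℕ :=
  ∑ i : Fin 4, if v ∈ e i then 2 ^ (i : ℕ) else 0

theorem testBit_column (e : Fin 4 → Finset ℕ) (v : ℕ) (i : Fin 4) :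
    (column e v).testBit i = decide (v ∈ e i) := by
  simp only [column, Fin.sum_univ_four]
  by_cases h0 : v ∈ e 0 <;> by_cases h1 : v ∈ e 1 <;> by_cases h2 : v ∈ e 2 <;>
    by_cases h3 : v ∈ e 3 <;> simp only [h0, h1, h2, h3, if_true, if_false] <;>
    fin_cases i <;> simp [h0, h1, h2, h3] <;> decide

theorem column_lt (e : Fin 4 → Finset ℕ) (v : ℕ) : column e v < 16 := by
  simp only [column, Fin.sum_univ_four]
  split_ifs <;> decide

theorem column_ne_zero {e : Fin 4 → Finset ℕ} {v : ℕ} {i : Fin 4} (h : v ∈ e i) :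
    column e v ≠ 0 := fun h0 => by
  have := testBit_column e v i
  simp [h0, h] at this

theorem exists_tie_of_tiesAlong (e : Fin 4 → Finset ℕ) (l : List ℕ) (x : Fin 4 → ℕ)
    (hl : l.Nodup) (h : TiesAlong x (l.map (column e))) (u : ℕ) (hu : u ∈ l) :
    ∃ i j : Fin 4, i ≠ j ∧ (u ∈ e i ↔ u ∈ e j) ∧
      x i + ((e i).filter fun w => w ∈ l ∧ l.idxOf w < l.idxOf u).card =
      x j + ((e j).filter fun w => w ∈ l ∧ l.idxOf w < l.idxOf u).card := by
  induction l generalizing x with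
  | nil => simp at hu
  | cons a l ih =>
    obtain ⟨ht, hT⟩ := h
    obtain ⟨ha, hl⟩ := List.nodup_cons.1 hl
    by_cases hua : u = a
    · subst hua
      obtain ⟨i, j, hij, hx, hc⟩ := exists_of_ties ht
      rw [testBit_column, testBit_column, decide_eq_decide] at hc
      exact ⟨i, j, hij, hc, by simpa using hx⟩
    · have hul : u ∈ l := (List.mem_cons.1 hu).resolve_left hua
      obtain ⟨i, j, hij, hc, hx⟩ := ih _ hl hT hul
      have key : ∀ i : Fin 4, x i + ((e i).filter fun w =>
            w ∈ a :: l ∧ (a :: l).idxOf w < (a :: l).idxOf u).card =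
          addColumn x (column e a) i +
            ((e i).filter fun w => w ∈ l ∧ l.idxOf w < l.idxOf u).card := fun i => by
        have hfilter : ((e i).filter fun w => w ∈ a :: l ∧ (a :: l).idxOf w < (a :: l).idxOf u) =
            ((e i).filter (· = a)) ∪ (e i).filter fun w => w ∈ l ∧ l.idxOf w < l.idxOf u := by
          rw [← filter_or]
          refine filter_congr fun w _ => ?_
          rw [List.idxOf_cons_ne _ (Ne.symm hua)]
          by_cases hwa : w = a
          · simp [hwa]
          · rw [List.idxOf_cons_ne _ (Ne.symm hwa)]
            simp [hwa]
        have hdisj : Disjoint ((e i).filter (· = a))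
            ((e i).filter fun w => w ∈ l ∧ l.idxOf w < l.idxOf u) :=
          disjoint_filter.2 fun w _ hw hw' => ha (hw ▸ hw'.1)
        rw [hfilter, card_union_of_disjoint hdisj, addColumn, testBit_column, filter_eq']
        split_ifs with h <;> simp [h, add_assoc]
      exact ⟨i, j, hij, hc, by rw [key, key, hx]⟩

/-- Every `3`-graph with four edges and no isolated vertices is orderable. -/
theorem HGraph.orderable_core_of_card_eq_four {H : HGraph} (hH : H.IsUniform 3)
    (hcard : H.edges.card = 4) : H.core.Orderable := by
  classical
  let e : Fin 4 → Finset ℕ := fun i => (H.edges.equivFinOfCardEq hcard).symm i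
  have he : ∀ i, e i ∈ H.edges := fun i => ((H.edges.equivFinOfCardEq hcard).symm i).2
  have hinj : Function.Injective e :=
    Subtype.val_injective.comp (H.edges.equivFinOfCardEq hcard).symm.injective
  have hsurj : ∀ d ∈ H.edges, ∃ i, e i = d := fun d hd =>
    ⟨H.edges.equivFinOfCardEq hcard ⟨d, hd⟩, by simp [e]⟩
  set U := (univ : Finset (Fin 4)).biUnion e
  have hU : H.core.verts = U := by
    ext v
    simp only [HGraph.mem_core_verts, U, mem_biUnion, mem_univ, true_and]
    constructor
    · rintro ⟨-, d, hd, hv⟩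
      obtain ⟨i, rfl⟩ := hsurj d hd
      exact ⟨i, hv⟩
    · rintro ⟨i, hi⟩
      exact ⟨(hH _ (he i)).1 hi, _, he i, hi⟩
  have hUcard : U.card ≤ 12 := by
    refine card_biUnion_le.trans ?_
    simp [fun i => (hH _ (he i)).2]
  obtain ⟨L', hL', hT⟩ := exists_perm_tiesAlong (U.toList.map (column e)) (by simpa using hUcard)
    (fun c hc => by
      obtain ⟨v, hv, rfl⟩ := List.mem_map.1 hc
      obtain ⟨i, -, hi⟩ := mem_biUnion.1 (mem_toList.1 hv)
      exact ⟨column_ne_zero hi, column_lt e v⟩)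
    (fun i => by
      rw [List.countP_map, ← (hH _ (he i)).2]
      have : e i = U.filter (· ∈ e i) := by
        ext v
        simp only [mem_filter, U, mem_biUnion, mem_univ, true_and]
        exact ⟨fun h => ⟨⟨i, h⟩, h⟩, fun h => h.2⟩
      conv_rhs => rw [this]
      rw [card_def, filter_val, ← Multiset.countP_eq_card_filter, ← coe_toList U,
        Multiset.coe_countP]
      exact List.countP_congr fun v _ => by simp [testBit_column])
  obtain ⟨l, rfl, hl⟩ : ∃ l : List ℕ, l.map (column e) = L' ∧ l.Perm U.toList := by
    have h : Relation.Comp (· = List.map (column e) ·) List.Perm L' U.toList := by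
      rw [List.eq_map_comp_perm]
      exact hL'
    obtain ⟨l, h₁, h₂⟩ := h
    exact ⟨l, h₁.symm, h₂⟩
  have hmem : ∀ v, v ∈ l ↔ v ∈ U := fun v => by rw [hl.mem_iff, mem_toList]
  refine ⟨l.idxOf, fun v hv w hw h => ?_, fun u hu => ?_⟩
  · rw [hU, mem_coe, ← hmem] at hv hw
    exact (List.idxOf_inj hv).1 h
  · rw [hU, ← hmem] at hu
    obtain ⟨i, j, hij, hiff, hc⟩ := exists_tie_of_tiesAlong e l _
      (hl.nodup_iff.2 (nodup_toList U)) hT u hu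
    refine ⟨e i, he i, e j, he j, hinj.ne hij, hiff, ?_⟩
    have key : ∀ i, ((e i).filter fun w => w ∈ l ∧ l.idxOf w < l.idxOf u) =
        (e i).filter (l.idxOf · < l.idxOf u) := fun i =>
      filter_congr fun w hw => by
        have : w ∈ l := (hmem w).2 (mem_biUnion.2 ⟨i, mem_univ i, hw⟩)
        simp [this]
    simpa [key] using hc

theorem HGraph.orderable {H : HGraph} (hH : H.IsUniform 3)
    (hcase : 4 ≤ H.edges.card ∨ (H.edges.card = 3 ∧
      (Isomorphic H.core TP3 ∨ Isomorphic H.core SP3 ∨ Isomorphic H.core LC3))) :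
    H.Orderable := by
  have hsub : ∀ e ∈ H.edges, e ⊆ H.verts := fun e he => (hH e he).1
  rcases hcase with h | ⟨h, hiso⟩
  · obtain ⟨E, hE, hcard⟩ := exists_subset_card_eq h
    have hK : HGraph.IsUniform ⟨H.verts, E⟩ 3 := fun e he => hH e (hE he)
    exact .mono (K := ⟨H.verts, E⟩) rfl hE
      (.of_core (fun e he => hsub e (hE he)) (by simp [hcard])
        (HGraph.orderable_core_of_card_eq_four hK hcard))
  · refine .of_core hsub (by omega) ?_
    have hcore : ∀ e ∈ H.core.edges, e ⊆ H.core.verts := fun e he v hv =>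
      HGraph.mem_core_verts.2 ⟨hsub e he hv, e, he, hv⟩
    rcases hiso with hiso | hiso | hiso
    · exact orderable_TP3.of_isomorphic hcore hiso
    · exact orderable_SP3.of_isomorphic hcore hiso
    · exact orderable_LC3.of_isomorphic hcore hiso

/-! ### Ramsey numbers of uniform hypergraphs -/

/-- Every colouring with at most `q` colours of the `t`-subsets of a set with at least `N` elements
has a homogeneous set with `m` elements. -/
def PartitionRel (t q m N : ℕ) : Prop :=
  ∀ (κ : Type) [Fintype κ], Fintype.card κ ≤ q → ∀ (χ : Finset ℕ → κ) (S : Finset ℕ),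
    N ≤ S.card → ∃ M ⊆ S, M.card = m ∧
      ∀ e ⊆ M, ∀ e' ⊆ M, e.card = t → e'.card = t → χ e = χ e'

theorem partitionRel_one (q m : ℕ) : PartitionRel 1 q m (q * m) := by
  classical
  intro κ _ hκ χ S hS
  obtain ⟨c, -, hc⟩ := exists_le_card_fiber_of_mul_le_card_of_maps_to
    (s := S) (t := (univ : Finset κ)) (f := fun x => χ {x}) (n := m)
    (fun _ _ => mem_univ _) ⟨χ ∅, mem_univ _⟩ ((Nat.mul_le_mul_right m hκ).trans hS)
  obtain ⟨M, hM, hcard⟩ := exists_subset_card_eq hc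
  have key : ∀ e ⊆ M, e.card = 1 → χ e = c := fun e he h => by
    obtain ⟨x, rfl⟩ := card_eq_one.1 h
    exact (mem_filter.1 (hM (he (mem_singleton_self x)))).2
  exact ⟨M, hM.trans (filter_subset _ _), hcard, fun e he e' he' h h' => by
    rw [key e he h, key e' he' h']⟩

/-- The Erdős–Rado construction of an end-homogeneous set `X`, together with a set `R` of remaining
elements. -/
theorem exists_endHomogeneous {κ : Type} [Fintype κ] {q t N : ℕ} (ht : 0 < t)
    (hκ : Fintype.card κ ≤ q) (χ : Finset ℕ → κ) (S : Finset ℕ)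
    (hS : (2 * q ^ N ^ t) ^ N ≤ S.card) (i : ℕ) (hi : i ≤ N) :
    ∃ X ⊆ S, ∃ R ⊆ S, X.card = i ∧ (2 * q ^ N ^ t) ^ (N - i) ≤ R.card ∧
      (∀ x ∈ X, ∀ r ∈ R, x < r) ∧
      (∀ e ⊆ X, e.card = t → ∀ r ∈ R, ∀ r' ∈ R, χ (insert r e) = χ (insert r' e)) ∧
      ∀ e ⊆ X, e.card = t → ∀ z ∈ X, (∀ a ∈ e, a < z) → ∀ r ∈ R,
        χ (insert z e) = χ (insert r e) := by
  classical
  have hq : 0 < q := (Fintype.card_pos_iff.2 ⟨χ ∅⟩).trans_le hκ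
  induction i with
  | zero =>
    refine ⟨∅, empty_subset _, S, Subset.rfl, card_empty, hS, by simp, fun e he het => ?_, by simp⟩
    rw [subset_empty.1 he, card_empty] at het
    omega
  | succ i ih =>
    obtain ⟨X, hXS, R, hRS, hX, hR, hlt, hχ, hend⟩ := ih (by omega)
    have hRpos : 0 < R.card := lt_of_lt_of_le (by positivity) hR
    set x := R.min' (card_pos.1 hRpos)
    have hxR : x ∈ R := min'_mem _ _
    have hxX : x ∉ X := fun h => (hlt x h x hxR).false
    let g : ℕ → ((insert x X).powersetCard t → κ) := fun z e => χ (insert z e)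
    have hK : Fintype.card ((insert x X).powersetCard t → κ) ≤ q ^ N ^ t := by
      rw [Fintype.card_fun, Fintype.card_coe, card_powersetCard, card_insert_of_notMem hxX, hX]
      exact (Nat.pow_le_pow_left hκ _).trans (Nat.pow_le_pow_right hq
        ((Nat.choose_le_pow _ _).trans (Nat.pow_le_pow_left hi t)))
    have hpow : (2 * q ^ N ^ t) ^ (N - i) =
        2 * (q ^ N ^ t * (2 * q ^ N ^ t) ^ (N - (i + 1))) := by
      rw [show N - i = N - (i + 1) + 1 by omega, pow_succ]
      ring
    have hpos : 0 < q ^ N ^ t * (2 * q ^ N ^ t) ^ (N - (i + 1)) := by positivity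
    obtain ⟨c, -, hc⟩ := exists_le_card_fiber_of_mul_le_card_of_maps_to
      (s := R.erase x) (t := univ) (f := g) (n := (2 * q ^ N ^ t) ^ (N - (i + 1)))
      (fun _ _ => mem_univ _) ⟨g 0, mem_univ _⟩ (by
        rw [card_erase_of_mem hxR, card_univ]
        refine (Nat.mul_le_mul_right _ hK).trans ?_
        omega)
    have hsub : (R.erase x).filter (g · = c) ⊆ R := (filter_subset _ _).trans (erase_subset _ _)
    have heX : ∀ e ⊆ insert x X, ∀ z ∈ insert x X, (∀ a ∈ e, a < z) → e ⊆ X := by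
      intro e he z hz hez a ha
      refine (mem_insert.1 (he ha)).resolve_left fun hax => ?_
      have := hez a ha
      rcases mem_insert.1 hz with rfl | hz
      · omega
      · have := hlt z hz x hxR
        omega
    refine ⟨insert x X, insert_subset (hRS hxR) hXS, (R.erase x).filter (g · = c),
      hsub.trans hRS, by rw [card_insert_of_notMem hxX, hX], hc, fun y hy r hr => ?_,
      fun e he het r hr r' hr' => ?_, fun e he het z hz hez r hr => ?_⟩
    · rcases mem_insert.1 hy with rfl | hy
      · have hr' := mem_erase.1 (mem_filter.1 hr).1
        exact lt_of_le_of_ne (min'_le _ _ hr'.2) (Ne.symm hr'.1)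
      · exact hlt y hy r (hsub hr)
    · have := (mem_filter.1 hr).2.trans (mem_filter.1 hr').2.symm
      exact congrFun this ⟨e, mem_powersetCard.2 ⟨he, het⟩⟩
    · have he' := heX e he z hz hez
      rcases mem_insert.1 hz with rfl | hz
      · exact hχ e he' het _ hxR r (hsub hr)
      · exact hend e he' het z hz hez r (hsub hr)

theorem PartitionRel.succ {t q m N : ℕ} (h : PartitionRel t q m N) (ht : 0 < t) :
    PartitionRel (t + 1) q m ((2 * q ^ N ^ t) ^ N) := by
  classical
  intro κ _ hκ χ S hS
  obtain ⟨X, hXS, R, -, hX, hR, -, -, hend⟩ := exists_endHomogeneous ht hκ χ S hS N le_rfl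
  obtain ⟨y, hy⟩ : R.Nonempty := card_pos.1 (by simpa using hR)
  obtain ⟨M, hMX, hM, hhom⟩ := h κ hκ (fun e => χ (insert y e)) X hX.ge
  refine ⟨M, hMX.trans hXS, hM, ?_⟩
  have key : ∀ e ⊆ M, e.card = t + 1 →
      ∃ d ⊆ M, d.card = t ∧ χ e = χ (insert y d) := fun e he hcard => by
    have hne : e.Nonempty := card_pos.1 (by omega)
    have hmem := e.max'_mem hne
    have hd : e.erase (e.max' hne) ⊆ M := (erase_subset _ _).trans he
    have hdcard : (e.erase (e.max' hne)).card = t := by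
      rw [card_erase_of_mem hmem]
      omega
    refine ⟨e.erase (e.max' hne), hd, hdcard, ?_⟩
    rw [← hend _ (hd.trans hMX) hdcard _ (hMX (he hmem))
      (fun a ha => lt_max'_of_mem_erase_max' _ _ ha) y hy, insert_erase hmem]
  intro e he e' he' hcard hcard'
  obtain ⟨d, hd, hdc, hde⟩ := key e he hcard
  obtain ⟨d', hd', hdc', hde'⟩ := key e' he' hcard'
  rw [hde, hde', hhom d hd d' hd' hdc hdc']

/-- An upper bound for the Ramsey number of `(t + 1)`-sets, `q` colours and homogeneous sets with
`m` elements. -/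
def ramseyBound (q m : ℕ) : ℕ → ℕ
  | 0 => q * m
  | t + 1 => (2 * q ^ ramseyBound q m t ^ (t + 1)) ^ ramseyBound q m t

theorem partitionRel_ramseyBound (q m t : ℕ) : PartitionRel (t + 1) q m (ramseyBound q m t) := by
  induction t with
  | zero => exact partitionRel_one q m
  | succ t ih => exact ih.succ t.succ_pos

/-! ### Local colourings restricted to a homogeneous set -/

theorem nth_card_filter_lt {s : Finset ℕ} {u : ℕ} (hu : u ∈ s) :
    Nat.nth (· ∈ s) (s.filter (· < u)).card = u := by
  classical
  have : (s.filter (· < u)).card = Nat.count (· ∈ s) u := by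
    rw [Nat.count_eq_card_filter_range]
    congr 1
    ext x
    simp [and_comm]
  rw [this, Nat.nth_count hu]

/-- The colours `f u e` for all `u ∈ s` and `e ∈ {s \ {u}, s \ {max s}}`, where `s` is
a `4`-set. -/
noncomputable def localPattern {k : ℕ} (f : ℕ → Finset ℕ → Fin k) (s : Finset ℕ) :
    Fin 4 ⊕ Fin 3 → Fin k :=
  Sum.elim (fun i => f (Nat.nth (· ∈ s) i) (s.erase (Nat.nth (· ∈ s) i)))
    (fun i => f (Nat.nth (· ∈ s) i) (s.erase (Nat.nth (· ∈ s) 3)))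

theorem apply_eq_localPattern_of_notMem {k : ℕ} (f : ℕ → Finset ℕ → Fin k) {e : Finset ℕ} {u : ℕ}
    (hu : u ∉ e) (i : Fin 4) (hi : (i : ℕ) = (e.filter (· < u)).card) :
    f u e = localPattern f (insert u e) (Sum.inl i) := by
  have hfilter : (insert u e).filter (· < u) = e.filter (· < u) := by
    rw [filter_insert, if_neg (lt_irrefl u)]
  have hnth : Nat.nth (· ∈ insert u e) i = u := by
    rw [hi, ← hfilter, nth_card_filter_lt (mem_insert_self u e)]
  rw [localPattern, Sum.elim_inl, hnth, erase_insert hu]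

theorem apply_eq_localPattern_of_mem {k : ℕ} (f : ℕ → Finset ℕ → Fin k) {e : Finset ℕ} {u z : ℕ}
    (he : e.card = 3) (hz : ∀ a ∈ e, a < z) (hu : u ∈ e) (i : Fin 3)
    (hi : (i : ℕ) = (e.filter (· < u)).card) :
    f u e = localPattern f (insert z e) (Sum.inr i) := by
  have hze : z ∉ e := fun h => (hz z h).false
  have hfilter : (insert z e).filter (· < u) = e.filter (· < u) := by
    rw [filter_insert, if_neg (hz u hu).not_gt]
  have hnth : Nat.nth (· ∈ insert z e) i = u := by
    rw [hi, ← hfilter, nth_card_filter_lt (mem_insert_of_mem hu)]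
  have hnth' : Nat.nth (· ∈ insert z e) 3 = z := by
    have h := nth_card_filter_lt (mem_insert_self z e)
    rwa [filter_insert, if_neg (lt_irrefl z), filter_true_of_mem hz, he] at h
  rw [localPattern, Sum.elim_inr, hnth, hnth', erase_insert hze]

/-- A set with more elements than `V` contains a copy of `V`, ordered by `ρ`, below one of
its elements. -/
theorem exists_orderEmbedding_below {V M : Finset ℕ} {ρ : ℕ → ℕ} (hρ : Set.InjOn ρ V)
    (hM : M.card = V.card + 1) :
    ∃ (φ : ℕ → ℕ) (z : ℕ), z ∈ M ∧ (∀ v ∈ V, φ v ∈ M ∧ φ v < z) ∧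
      ∀ v ∈ V, ∀ w ∈ V, φ v < φ w ↔ ρ v < ρ w := by
  classical
  let r : ℕ → ℕ := fun v => (V.filter (ρ · < ρ v)).card
  have hr : ∀ v ∈ V, r v < V.card := fun v hv =>
    card_lt_card (filter_ssubset.2 ⟨v, hv, lt_irrefl _⟩)
  have hmono : ∀ v ∈ V, ∀ w, ρ v < ρ w → r v < r w := fun v hv w hvw =>
    card_lt_card (ssubset_iff_of_subset (fun x hx => by
      rw [mem_filter] at hx ⊢
      exact ⟨hx.1, hx.2.trans hvw⟩) |>.2 ⟨v, by simp [hv, hvw], by simp⟩)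
  have hfin : (Set.ofPred (· ∈ M)).Finite := M.finite_toSet
  have hcard : hfin.toFinset.card = V.card + 1 := by
    rw [← hM]
    congr 1
    ext x
    rw [Set.Finite.mem_toFinset]
    rfl
  have hlt : ∀ v ∈ V, ∀ w ∈ V, ρ v < ρ w → Nat.nth (· ∈ M) (r v) < Nat.nth (· ∈ M) (r w) :=
    fun v hv w hw h => Nat.nth_lt_nth_of_lt_card hfin (hmono v hv w h) (by
      have := hr w hw
      omega)
  refine ⟨fun v => Nat.nth (· ∈ M) (r v), Nat.nth (· ∈ M) V.card,
    Nat.nth_mem_of_lt_card hfin (by omega), fun v hv => ⟨Nat.nth_mem_of_lt_card hfin (by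
      have := hr v hv
      omega), Nat.nth_lt_nth_of_lt_card hfin (hr v hv) (by omega)⟩,
    fun v hv w hw => ⟨fun h => ?_, hlt v hv w hw⟩⟩
  rcases lt_trichotomy (ρ v) (ρ w) with h' | h' | h'
  · exact h'
  · rw [hρ hv hw h'] at h
    exact absurd h (lt_irrefl _)
  · exact absurd h (hlt w hw v hv h').not_gt

theorem lt_ramseyBound_of_isLocalColoring {H : HGraph} (hH : H.IsUniform 3) (hord : H.Orderable)
    {n k q : ℕ} {f : ℕ → Finset ℕ → Fin k} (hf : IsLocalColoring n k H f) (hq : k ^ 7 ≤ q) :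
    n < ramseyBound q (H.verts.card + 1) 3 := by
  classical
  by_contra! hn
  obtain ⟨M, hMn, hM, hhom⟩ := partitionRel_ramseyBound q (H.verts.card + 1) 3
    (Fin 4 ⊕ Fin 3 → Fin k) (by simpa using hq) (localPattern f) (range n) (by simpa using hn)
  obtain ⟨ρ, hρ, hord⟩ := hord
  obtain ⟨φ, z, hzM, hφ, hlt⟩ := exists_orderEmbedding_below hρ hM
  have hinj : Set.InjOn φ H.verts := fun v hv w hw h => by
    have h₁ := hlt v hv w hw
    have h₂ := hlt w hw v hv
    exact hρ hv hw (by omega)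
  obtain ⟨u, hu, hrainbow⟩ := hf φ ⟨hinj, fun v hv => hMn (hφ v hv).1⟩
  obtain ⟨e₁, he₁, e₂, he₂, hne, hmem, hcard⟩ := hord u hu
  have himage : ∀ e ∈ H.edges, (e.image φ).card = 3 ∧ e.image φ ⊆ M ∧
      (∀ a ∈ e.image φ, a < z) ∧ (φ u ∈ e.image φ ↔ u ∈ e) ∧
      ((e.image φ).filter (· < φ u)).card = (e.filter (ρ · < ρ u)).card := fun e he => by
    have hev := (hH e he).1
    refine ⟨?_, fun a ha => ?_, fun a ha => ?_, ⟨fun h => ?_, mem_image_of_mem φ⟩, ?_⟩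
    · rw [card_image_of_injOn (hinj.mono hev), (hH e he).2]
    · obtain ⟨v, hv, rfl⟩ := mem_image.1 ha
      exact (hφ v (hev hv)).1
    · obtain ⟨v, hv, rfl⟩ := mem_image.1 ha
      exact (hφ v (hev hv)).2
    · obtain ⟨v, hv, hvu⟩ := mem_image.1 h
      rwa [← hinj (hev hv) hu hvu]
    · rw [filter_image, card_image_of_injOn (hinj.mono fun x hx => hev (mem_filter.1 hx).1)]
      exact congrArg card (filter_congr fun v hv => hlt v (hev hv) u hu)
  obtain ⟨hc₁, hM₁, hz₁, hm₁, hp₁⟩ := himage e₁ he₁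
  obtain ⟨hc₂, hM₂, hz₂, hm₂, hp₂⟩ := himage e₂ he₂
  have hpos : ((e₁.image φ).filter (· < φ u)).card = ((e₂.image φ).filter (· < φ u)).card := by
    rw [hp₁, hp₂, hcard]
  refine hne (hrainbow e₁ he₁ e₂ he₂ ?_)
  by_cases hu₁ : u ∈ e₁
  · have hu₂ := hm₂.2 (hmem.1 hu₁)
    have hi : ((e₁.image φ).filter (· < φ u)).card < 3 := hc₁ ▸
      card_lt_card (filter_ssubset.2 ⟨φ u, hm₁.2 hu₁, lt_irrefl _⟩)
    rw [apply_eq_localPattern_of_mem f hc₁ hz₁ (hm₁.2 hu₁) ⟨_, hi⟩ rfl,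
      apply_eq_localPattern_of_mem f hc₂ hz₂ hu₂ ⟨_, hi⟩ hpos]
    refine congrFun (hhom _ (insert_subset hzM hM₁) _ (insert_subset hzM hM₂) ?_ ?_) _
    · rw [card_insert_of_notMem fun h => (hz₁ z h).false, hc₁]
    · rw [card_insert_of_notMem fun h => (hz₂ z h).false, hc₂]
  · have hu₁' := mt hm₁.1 hu₁
    have hu₂' := mt hm₂.1 (mt hmem.2 hu₁)
    have hi : ((e₁.image φ).filter (· < φ u)).card < 4 :=
      (card_filter_le _ _).trans_lt (by omega)
    have huM := (hφ u hu).1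
    rw [apply_eq_localPattern_of_notMem f hu₁' ⟨_, hi⟩ rfl,
      apply_eq_localPattern_of_notMem f hu₂' ⟨_, hi⟩ hpos]
    refine congrFun (hhom _ (insert_subset huM hM₁) _ (insert_subset huM hM₂) ?_ ?_) _
    · rw [card_insert_of_notMem hu₁', hc₁]
    · rw [card_insert_of_notMem hu₂', hc₂]

/-- With sufficiently many colours there is a local colouring. -/
theorem exists_isLocalColoring {H : HGraph} (hH : H.IsUniform 3) (hne : H.edges.Nonempty) (n : ℕ) :
    ∃ k, ∃ f : ℕ → Finset ℕ → Fin k, IsLocalColoring n k H f := by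
  classical
  refine ⟨Fintype.card ((range n).powerset), fun _ e =>
    Fintype.equivFin _ ⟨e ∩ range n, mem_powerset.2 inter_subset_right⟩, fun φ hφ => ?_⟩
  obtain ⟨e, he⟩ := hne
  obtain ⟨x, hx⟩ : e.Nonempty := card_pos.1 (by rw [(hH e he).2]; norm_num)
  have himage : ∀ d ∈ H.edges, d.image φ ∩ range n = d.image φ := fun d hd =>
    inter_eq_left.2 fun y hy => by
      obtain ⟨v, hv, rfl⟩ := mem_image.1 hy
      exact hφ.2 v ((hH d hd).1 hv)
  refine ⟨x, (hH e he).1 hx, fun e₁ he₁ e₂ he₂ h => ?_⟩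
  have h' := Subtype.mk.inj ((Fintype.equivFin _).injective h)
  rw [himage e₁ he₁, himage e₂ he₂] at h'
  rw [← coe_inj, coe_image, coe_image] at h'
  exact coe_inj.1 ((hφ.1.image_eq_image_iff (hH e₁ he₁).1 (hH e₂ he₂).1).1 h')

/-! ### Numerical estimates -/

theorem two_mul_pow_pow_le {a b q N t : ℕ} (hq : q ≤ 2 ^ a) (ha : 0 < a) (hN : 0 < N)
    (hb : 2 * a * N ^ (t + 1) ≤ b) : (2 * q ^ N ^ t) ^ N ≤ 2 ^ b := by
  have h₁ : 2 * q ^ N ^ t ≤ 2 ^ (2 * a * N ^ t) := calc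
    2 * q ^ N ^ t ≤ 2 * (2 ^ a) ^ N ^ t := Nat.mul_le_mul_left _ (Nat.pow_le_pow_left hq _)
    _ = 2 ^ (a * N ^ t + 1) := by rw [← pow_mul, pow_succ, mul_comm]
    _ ≤ 2 ^ (2 * a * N ^ t) := Nat.pow_le_pow_right (by norm_num) (by
      have : 0 < a * N ^ t := by positivity
      nlinarith)
  calc (2 * q ^ N ^ t) ^ N ≤ (2 ^ (2 * a * N ^ t)) ^ N := Nat.pow_le_pow_left h₁ _
    _ = 2 ^ (2 * a * N ^ (t + 1)) := by rw [← pow_mul, pow_succ, ← mul_assoc]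
    _ ≤ 2 ^ b := Nat.pow_le_pow_right (by norm_num) hb

theorem ramseyBound_three_le {a q m : ℕ} (hq : q ≤ 2 ^ a) (hq0 : 0 < q) (ha : 0 < a) (hm : 0 < m) :
    ramseyBound q m 3 ≤ 2 ^ 2 ^ 2 ^ (7 * (2 * a * (q * m) ^ 2)) := by
  set b := 2 * a * (q * m) ^ 2 with hb
  have hab : 2 * a ≤ b := Nat.le_mul_of_pos_right _ (by positivity)
  have hb0 : 0 < b := by omega
  have hbb : b < 2 ^ b := Nat.lt_two_pow_self
  have h0 : 0 < ramseyBound q m 0 := Nat.mul_pos hq0 hm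
  have hpos : ∀ t, 0 < ramseyBound q m t := fun t => by
    induction t with
    | zero => exact h0
    | succ t ih => exact Nat.pow_pos (by positivity)
  have h1 : ramseyBound q m 1 ≤ 2 ^ b := two_mul_pow_pow_le hq ha h0 le_rfl
  have h2 : ramseyBound q m 2 ≤ 2 ^ 2 ^ (4 * b) :=
    two_mul_pow_pow_le hq ha (hpos 1) <| calc
      2 * a * ramseyBound q m 1 ^ 3 ≤ 2 ^ b * (2 ^ b) ^ 3 :=
        Nat.mul_le_mul (by omega) (Nat.pow_le_pow_left h1 3)
      _ = 2 ^ (4 * b) := by rw [← pow_mul, ← pow_add]; congr 1; ring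
  refine two_mul_pow_pow_le hq ha (hpos 2) <| calc
      2 * a * ramseyBound q m 2 ^ 4 ≤ 2 ^ b * (2 ^ 2 ^ (4 * b)) ^ 4 :=
        Nat.mul_le_mul (by omega) (Nat.pow_le_pow_left h2 4)
      _ = 2 ^ (b + 2 ^ (4 * b) * 4) := by rw [← pow_mul, ← pow_add]
      _ ≤ 2 ^ 2 ^ (7 * b) := Nat.pow_le_pow_right (by norm_num) ?_
  calc b + 2 ^ (4 * b) * 4 ≤ 2 ^ (4 * b) * 8 := by
        have : 2 ^ b ≤ 2 ^ (4 * b) := Nat.pow_le_pow_right (by norm_num) (by omega)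
        omega
    _ = 2 ^ (4 * b + 3) := by rw [pow_add]; norm_num
    _ ≤ 2 ^ (7 * b) := Nat.pow_le_pow_right (by norm_num) (by omega)

theorem tendsto_iterLog (j : ℕ) : Filter.Tendsto (iterLog j) Filter.atTop Filter.atTop := by
  induction j with
  | zero => exact Filter.tendsto_id
  | succ j ih => exact Real.tendsto_log_atTop.comp ih

theorem log_le_of_le_two_pow {x : ℝ} {y : ℕ} (hx : 0 < x) (h : x ≤ 2 ^ y) : Real.log x ≤ y := by
  refine (Real.log_le_log hx h).trans ?_
  rw [Real.log_pow]
  exact mul_le_of_le_one_right y.cast_nonneg (Real.log_two_lt_d9.le.trans (by norm_num))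

/-- The Ramsey number for `(2 * k) ^ 7` colours is at most triply exponential in a power of `k`. -/
theorem ramseyBound_three_le_pow {k m q : ℕ} (hk : 0 < k) (hm : 0 < m) (hq : q = (2 * k) ^ 7) :
    ramseyBound q m 3 ≤ 2 ^ 2 ^ 2 ^ ((196 * 2 ^ 15 * m ^ 2) * k ^ 16) := by
  have hq2 : q ≤ 2 ^ (7 * (2 * k)) := by
    rw [hq, mul_comm 7, pow_mul]
    exact Nat.pow_le_pow_left Nat.lt_two_pow_self.le 7
  refine (ramseyBound_three_le hq2 (by rw [hq]; positivity) (by omega) hm).trans ?_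
  refine Nat.pow_le_pow_right two_pos (Nat.pow_le_pow_right two_pos
    (Nat.pow_le_pow_right two_pos ?_))
  calc 7 * (2 * (7 * (2 * k)) * (q * m) ^ 2) = 196 * 2 ^ 14 * m ^ 2 * k ^ 15 := by rw [hq]; ring
    _ ≤ _ := Nat.mul_le_mul (by gcongr <;> norm_num) (Nat.pow_le_pow_right hk (by norm_num))

theorem stmt_8 (H : HGraph) (hH : H.IsUniform 3) (hcard : 3 ≤ H.edges.card)
    (hcase : 4 ≤ H.edges.card ∨ (H.edges.card = 3 ∧
      (Isomorphic H.core TP3 ∨ Isomorphic H.core SP3 ∨ Isomorphic H.core LC3))) :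
    ∃ c : ℝ, 0 < c ∧ ∃ n₀ : ℕ, ∀ n : ℕ, n₀ ≤ n →
      c * (iterLog 3 (n : ℝ) / iterLog 4 (n : ℝ)) ^ ((1 : ℝ) / 16) ≤ (localC n H : ℝ) := by
  set m := H.verts.card + 1
  set C : ℕ := 196 * 2 ^ 15 * m ^ 2 with hC
  have hC0 : (0 : ℝ) < C := by
    rw [hC]
    positivity
  have hlarge : ∀ᶠ n : ℕ in Filter.atTop, ∀ j ∈ range 5, 1 ≤ iterLog j (n : ℝ) :=
    (Filter.eventually_all_finset _).2 fun j _ =>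
      ((tendsto_iterLog j).comp tendsto_natCast_atTop_atTop).eventually_ge_atTop 1
  obtain ⟨n₀, hn₀⟩ := Filter.eventually_atTop.1 hlarge
  refine ⟨((C : ℝ) ^ ((1 : ℝ) / 16))⁻¹, by positivity, n₀, fun n hn => ?_⟩
  have hlog : ∀ j < 5, 1 ≤ iterLog j (n : ℝ) := fun j hj => hn₀ n hn j (mem_range.2 hj)
  have hne : H.edges.Nonempty := card_pos.1 (by omega)
  obtain ⟨f, hf⟩ := Nat.sInf_mem (exists_isLocalColoring hH hne n)
  change IsLocalColoring n (localC n H) H f at hf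
  set k := localC n H
  have hk : 0 < k := (f 0 ∅).pos
  have hbound : n ≤ 2 ^ 2 ^ 2 ^ (C * k ^ 16) :=
    (lt_ramseyBound_of_isLocalColoring hH (HGraph.orderable hH hcase) hf
      (Nat.pow_le_pow_left (by omega : k ≤ 2 * k) 7)).le.trans
      (ramseyBound_three_le_pow hk (Nat.succ_pos _) rfl)
  have h0 : (n : ℝ) ≤ 2 ^ (2 ^ 2 ^ (C * k ^ 16) : ℕ) := by exact_mod_cast hbound
  have h1 : iterLog 1 (n : ℝ) ≤ 2 ^ (2 ^ (C * k ^ 16) : ℕ) := by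
    have := log_le_of_le_two_pow (one_pos.trans_le (hlog 0 (by norm_num))) h0
    exact_mod_cast this
  have h2 : iterLog 2 (n : ℝ) ≤ 2 ^ (C * k ^ 16) := by
    have := log_le_of_le_two_pow (one_pos.trans_le (hlog 1 (by norm_num))) h1
    exact_mod_cast this
  have h3 : iterLog 3 (n : ℝ) ≤ C * (k : ℝ) ^ 16 := by
    have := log_le_of_le_two_pow (one_pos.trans_le (hlog 2 (by norm_num))) h2
    exact_mod_cast this
  have hl3 := hlog 3 (by norm_num)
  have hl4 := hlog 4 (by norm_num)
  rw [inv_mul_le_iff₀ (by positivity)]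
  calc (iterLog 3 (n : ℝ) / iterLog 4 (n : ℝ)) ^ ((1 : ℝ) / 16)
      ≤ (C * (k : ℝ) ^ 16) ^ ((1 : ℝ) / 16) := by
        refine Real.rpow_le_rpow (by positivity) ?_ (by norm_num)
        exact (div_le_self (by linarith) hl4).trans h3
    _ = (C : ℝ) ^ ((1 : ℝ) / 16) * k := by
        rw [Real.mul_rpow hC0.le (by positivity), ← Real.rpow_natCast_mul k.cast_nonneg]
        norm_num
end

section
/- There exist a constant c > 0 and an n_0 such that for all n ≥ n_0, C_3(n, SP_4^2) ≥ c · n^{1/7}. -/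
open Finset

/-- Starting vertex of the `j`-th edge of `SP_t^1`. -/
def sp1start (j : ℕ) : ℕ := if j % 2 = 1 then 3 * (j - 1) / 2 + 1 else 3 * j / 2

/-- The special path `SP_t^1` on vertex set `{1, …, ⌈(3t+3)/2⌉}`: consecutive edges
alternately share one vertex and two vertices, beginning with an overlap of one vertex. -/
def SP1 (t : ℕ) : HGraph :=
  ⟨Finset.Icc 1 ((3 * t + 4) / 2),
   (Finset.Icc 1 t).image fun j => {sp1start j, sp1start j + 1, sp1start j + 2}⟩

/-- Starting vertex of the `j`-th edge of `SP_t^2`. -/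
def sp2start (j : ℕ) : ℕ := if j % 2 = 1 then 3 * (j - 1) / 2 + 1 else (3 * j - 2) / 2

/-- The special path `SP_t^2` on vertex set `{1, …, ⌈(3t+2)/2⌉}`: consecutive edges
alternately share two vertices and one vertex, beginning with an overlap of two vertices. -/
def SP2 (t : ℕ) : HGraph :=
  ⟨Finset.Icc 1 ((3 * t + 3) / 2),
   (Finset.Icc 1 t).image fun j => {sp2start j, sp2start j + 1, sp2start j + 2}⟩

lemma SP2_four_verts : (SP2 4).verts = {1, 2, 3, 4, 5, 6, 7} := by decide

lemma SP2_four_edges :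
    (SP2 4).edges = {{1, 2, 3}, {2, 3, 4}, {4, 5, 6}, {5, 6, 7}} := by decide

/-- In a local colouring for `SP2 4`, the seven vertices of a copy with edges `xab`, `aby`, `ycd`,
`cdz` cannot satisfy all of the following colour coincidences. -/
lemma IsLocalColoring.false_of_coincidences {n k : ℕ} {f : ℕ → Finset ℕ → Fin k}
    (hf : IsLocalColoring n k (SP2 4) f) {x a b y c d z : ℕ}
    (hnd : [x, a, b, y, c, d, z].Nodup) (hlt : ∀ v ∈ [x, a, b, y, c, d, z], v < n)
    (ha : f a {x, a, b} = f a {a, b, y}) (hb : f b {x, a, b} = f b {a, b, y})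
    (hc : f c {y, c, d} = f c {c, d, z}) (hd : f d {y, c, d} = f d {c, d, z})
    (hx : f x {a, b, y} = f x {y, c, d}) (hy : f y {a, b, y} = f y {y, c, d})
    (hz : f z {a, b, y} = f z {y, c, d}) : False := by
  obtain ⟨u, hu, h⟩ := hf (fun v => [x, a, b, y, c, d, z].getD (v - 1) 0) (by
    have hget : ∀ v ∈ (SP2 4).verts, ∃ h : v - 1 < [x, a, b, y, c, d, z].length,
        1 ≤ v ∧ [x, a, b, y, c, d, z].getD (v - 1) 0 = [x, a, b, y, c, d, z][v - 1] := by
      intro v hv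
      obtain ⟨h₁, h₇⟩ : 1 ≤ v ∧ v ≤ 7 := mem_Icc.mp hv
      have h : v - 1 < [x, a, b, y, c, d, z].length := by
        simp only [List.length_cons, List.length_nil]
        omega
      exact ⟨h, h₁, List.getD_eq_getElem _ _ h⟩
    refine ⟨fun v hv w hw hvw => ?_, fun v hv => ?_⟩
    · obtain ⟨hv, hv₁, hv'⟩ := hget v hv
      obtain ⟨hw, hw₁, hw'⟩ := hget w hw
      have := hnd.getElem_inj_iff.mp (hv'.symm.trans (hvw.trans hw'))
      omega
    · obtain ⟨hv, -, hv'⟩ := hget v hv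
      exact mem_range.mpr (hv'.trans_lt (hlt _ (List.getElem_mem hv))))
  rw [SP2_four_edges] at h
  rw [SP2_four_verts] at hu
  have h₁₂ := h {1, 2, 3} (by simp) {2, 3, 4} (by simp)
  have h₂₃ := h {2, 3, 4} (by simp) {4, 5, 6} (by simp)
  have h₃₄ := h {4, 5, 6} (by simp) {5, 6, 7} (by simp)
  have n₁₂ : ({1, 2, 3} : Finset ℕ) ≠ {2, 3, 4} := by decide
  have n₂₃ : ({2, 3, 4} : Finset ℕ) ≠ {4, 5, 6} := by decide
  have n₃₄ : ({4, 5, 6} : Finset ℕ) ≠ {5, 6, 7} := by decide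
  simp only [mem_insert, mem_singleton] at hu
  rcases hu with rfl | rfl | rfl | rfl | rfl | rfl | rfl
  · exact n₂₃ (h₂₃ (by simpa [image_insert] using hx))
  · exact n₁₂ (h₁₂ (by simpa [image_insert] using ha))
  · exact n₁₂ (h₁₂ (by simpa [image_insert] using hb))
  · exact n₂₃ (h₂₃ (by simpa [image_insert] using hy))
  · exact n₃₄ (h₃₄ (by simpa [image_insert] using hc))
  · exact n₃₄ (h₃₄ (by simpa [image_insert] using hd))
  · exact n₂₃ (h₂₃ (by simpa [image_insert] using hz))

/-- All but at most `2 * |β|` elements of `X` lie in a fibre of `g` with at least three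
elements. -/
lemma card_sub_le_card_filter_three_le_fiber {α β : Type*} [DecidableEq α] [DecidableEq β]
    [Fintype β] (X : Finset α) (g : α → β) :
    #X - 2 * Fintype.card β ≤ #{y ∈ X | 3 ≤ #{x ∈ X | g x = g y}} := by
  have hbad : #{y ∈ X | ¬ 3 ≤ #{x ∈ X | g x = g y}} ≤ 2 * #(univ : Finset β) := by
    refine card_le_mul_card_image_of_maps_to (f := g) (fun _ _ => mem_univ _) 2 fun b _ => ?_
    obtain h | ⟨y, hy⟩ := eq_empty_or_nonempty
      {a ∈ {y ∈ X | ¬ 3 ≤ #{x ∈ X | g x = g y}} | g a = b}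
    · rw [h]
      exact Nat.zero_le 2
    · simp only [mem_filter] at hy
      obtain ⟨⟨-, hy⟩, rfl⟩ := hy
      refine (card_le_card fun a ha => ?_).trans (Nat.lt_succ_iff.mp (not_le.mp hy))
      simp only [mem_filter] at ha ⊢
      exact ⟨ha.1.1, ha.2⟩
  have := card_filter_add_card_filter_not (s := X) (fun y => 3 ≤ #{x ∈ X | g x = g y})
  rw [card_univ] at hbad
  omega

lemma exists_pair_of_three_le_fiber {α β : Type*} [DecidableEq α] [DecidableEq β]
    {X : Finset α} {g : α → β} {y : α} (h : 3 ≤ #{x ∈ X | g x = g y}) :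
    ∃ p : α × α, p.1 ∈ X ∧ p.2 ∈ X ∧ p.1 ≠ y ∧ p.2 ≠ y ∧ p.1 ≠ p.2 ∧
      g p.1 = g y ∧ g p.2 = g y := by
  have h' : 1 < #({x ∈ X | g x = g y}.erase y) := by
    have := pred_card_le_card_erase (s := {x ∈ X | g x = g y}) (a := y)
    omega
  obtain ⟨x, hx, z, hz, hne⟩ := one_lt_card.mp h'
  simp only [mem_erase, mem_filter] at hx hz
  exact ⟨(x, z), hx.2.1, hz.2.1, hx.1, hz.1, hne, hx.2.2, hz.2.2⟩

/-- Given more than `27 * k ^ 7` colourings of `3 * k ^ 2` points with `k ^ 2` colours, some three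
points are monochromatic in more than `k ^ 3` of the colourings. -/
lemma exists_triple_monochromatic {k N : ℕ} (hk : 0 < k) (hN : 27 * k ^ 7 < N)
    (C : ℕ → ℕ → Fin k × Fin k) :
    ∃ x y z, x < 3 * k ^ 2 ∧ y < 3 * k ^ 2 ∧ z < 3 * k ^ 2 ∧ x ≠ y ∧ z ≠ y ∧ x ≠ z ∧
      ∃ I ⊆ range N, k ^ 3 < #I ∧ ∀ i ∈ I, C i x = C i y ∧ C i z = C i y := by
  set X := range (3 * k ^ 2) with hX
  let Y : ℕ → Finset ℕ := fun i => {y ∈ X | 3 ≤ #{x ∈ X | C i x = C i y}}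
  have hY : ∀ i, k ^ 2 ≤ #(Y i) := fun i => by
    have h := card_sub_le_card_filter_three_le_fiber X (C i)
    simp only [hX, card_range, Fintype.card_prod, Fintype.card_fin] at h
    refine le_trans ?_ h
    rw [← sq]
    omega
  have hpair : ∀ i y, ∃ p : ℕ × ℕ, y ∈ Y i → p.1 ∈ X ∧ p.2 ∈ X ∧ p.1 ≠ y ∧ p.2 ≠ y ∧
      p.1 ≠ p.2 ∧ C i p.1 = C i y ∧ C i p.2 = C i y := fun i y => by
    by_cases h : y ∈ Y i
    · obtain ⟨p, hp⟩ := exists_pair_of_three_le_fiber (mem_filter.mp h).2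
      exact ⟨p, fun _ => hp⟩
    · exact ⟨(0, 0), fun h' => absurd h' h⟩
  choose p hp using hpair
  let S : Finset (Σ _ : ℕ, ℕ) := (range N).sigma Y
  have hS : #(X ×ˢ X ×ˢ X) * k ^ 3 < #S := by
    have h₁ : N * k ^ 2 ≤ #S := by
      rw [card_sigma]
      simpa using card_nsmul_le_sum (range N) (fun i => #(Y i)) (k ^ 2) fun i _ => hY i
    refine lt_of_lt_of_le ?_ h₁
    calc #(X ×ˢ X ×ˢ X) * k ^ 3 = 27 * k ^ 7 * k ^ 2 := by
          simp only [card_product, hX, card_range]; ring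
      _ < N * k ^ 2 := Nat.mul_lt_mul_of_pos_right hN (by positivity)
  obtain ⟨⟨y, x, z⟩, -, hlt⟩ := exists_lt_card_fiber_of_mul_lt_card_of_maps_to
    (f := fun s : Σ _ : ℕ, ℕ => (s.2, p s.1 s.2)) (fun s hs => by
      obtain ⟨-, hs⟩ := mem_sigma.mp hs
      have := hp _ _ hs
      exact mem_product.mpr ⟨(mem_filter.mp hs).1, mem_product.mpr ⟨this.1, this.2.1⟩⟩) hS
  set F := {s ∈ S | (s.2, p s.1 s.2) = (y, x, z)} with hF
  have hmem : ∀ s ∈ F, s.1 ∈ range N ∧ y ∈ Y s.1 ∧ s.2 = y ∧ p s.1 y = (x, z) := by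
    rintro ⟨i, w⟩ hs
    simp only [hF, S, mem_filter, mem_sigma, Prod.mk.injEq] at hs
    obtain ⟨⟨hi, hw⟩, rfl, h⟩ := hs
    exact ⟨hi, hw, rfl, h⟩
  obtain ⟨s, hs⟩ := card_pos.mp (lt_of_le_of_lt (Nat.zero_le _) hlt)
  obtain ⟨-, hs₁, -, hs₂⟩ := hmem s hs
  have h := hp _ _ hs₁
  rw [hs₂] at h
  refine ⟨x, y, z, mem_range.mp h.1, mem_range.mp (mem_filter.mp hs₁).1, mem_range.mp h.2.1,
    h.2.2.1, h.2.2.2.1, h.2.2.2.2.1, F.image Sigma.fst, ?_, ?_, ?_⟩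
  · exact image_subset_iff.mpr fun s hs => (hmem s hs).1
  · rwa [card_image_of_injOn]
    rintro ⟨i, w⟩ hs ⟨j, w'⟩ ht hij
    obtain rfl := (hmem _ hs).2.2.1
    obtain rfl := (hmem _ ht).2.2.1
    obtain rfl : i = j := hij
    rfl
  · intro i hi
    obtain ⟨t, ht, rfl⟩ := mem_image.mp hi
    obtain ⟨-, ht₁, -, ht₂⟩ := hmem t ht
    have h := hp _ _ ht₁
    rw [ht₂] at h
    exact h.2.2.2.2.2

lemma IsLocalColoring.lt_of_SP2_four {n k : ℕ} {f : ℕ → Finset ℕ → Fin k}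
    (hf : IsLocalColoring n k (SP2 4) f) : n < 59 * k ^ 7 := by
  have hk : 0 < k := (f 0 ∅).pos
  by_contra! hn
  set M := 3 * k ^ 2 with hM
  set N := 27 * k ^ 7 + 1 with hN
  have hMN : M + 2 * N ≤ n := by
    have h₁ : k ^ 2 ≤ k ^ 7 := Nat.pow_le_pow_right hk (by norm_num)
    have h₂ : 0 < k ^ 7 := by positivity
    omega
  let a : ℕ → ℕ := fun i => M + 2 * i
  let b : ℕ → ℕ := fun i => M + 2 * i + 1
  obtain ⟨x, y, z, hx, hy, hz, hxy, hzy, hxz, I, hI, hcard, hC⟩ :=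
    exists_triple_monochromatic hk (Nat.lt_succ_self _)
      fun i v => (f (a i) {a i, b i, v}, f (b i) {a i, b i, v})
  obtain ⟨i, hi, j, hj, hij, hD⟩ := exists_ne_map_eq_of_card_lt_of_maps_to
    (s := I) (t := (univ : Finset (Fin k × Fin k × Fin k)))
    (by simpa [pow_succ, mul_assoc] using hcard)
    (f := fun i => (f x {a i, b i, y}, f y {a i, b i, y}, f z {a i, b i, y}))
    (fun _ _ => mem_univ _)
  simp only [Prod.mk.injEq] at hC hD
  have hiN := mem_range.mp (hI hi)
  have hjN := mem_range.mp (hI hj)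
  have rot : ∀ u v w : ℕ, ({u, v, w} : Finset ℕ) = {v, w, u} := fun u v w => by
    ext; simp; tauto
  refine hf.false_of_coincidences (x := x) (a := a i) (b := b i) (y := y) (c := a j) (d := b j)
    (z := z) ?_ ?_ ?_ ?_ ?_ ?_ ?_ ?_ ?_
  · simp only [List.nodup_cons, List.mem_cons, List.not_mem_nil, or_false, not_or,
      List.nodup_nil, not_false_eq_true, and_true, a, b]
    omega
  · simp only [List.forall_mem_cons, List.not_mem_nil, false_imp_iff, implies_true, and_true, a, b]
    omega
  · rw [rot x]; exact (hC i hi).1.1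
  · rw [rot x]; exact (hC i hi).1.2
  · rw [rot y]; exact (hC j hj).2.1.symm
  · rw [rot y]; exact (hC j hj).2.2.symm
  · rw [rot y]; exact hD.1
  · rw [rot y]; exact hD.2.1
  · rw [rot y]; exact hD.2.2

lemma eq_of_image_eq_of_isCopy {H : HGraph} {n : ℕ} {φ : ℕ → ℕ} (hφ : IsCopy n H φ)
    {e₁ e₂ : Finset ℕ} (h₁ : e₁ ⊆ H.verts) (h₂ : e₂ ⊆ H.verts)
    (h : e₁.image φ = e₂.image φ) : e₁ = e₂ := by
  have h' : φ '' (e₁ : Set ℕ) = φ '' (e₂ : Set ℕ) := by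
    rw [← coe_image, ← coe_image, h]
  exact coe_injective ((hφ.1.image_eq_image_iff (coe_subset.mpr h₁) (coe_subset.mpr h₂)).mp h')

/-- Colouring all edges differently is a local colouring. -/
lemma exists_isLocalColoring_s11 (n : ℕ) {H : HGraph} (hV : H.verts.Nonempty)
    (hE : ∀ e ∈ H.edges, e ⊆ H.verts) :
    ∃ k, ∃ f : ℕ → Finset ℕ → Fin k, IsLocalColoring n k H f := by
  have hmem : ∀ e : Finset ℕ, e ∩ range n ∈ (range n).powerset := fun e =>
    mem_powerset.mpr inter_subset_right
  refine ⟨_, fun _ e => (range n).powerset.equivFin ⟨e ∩ range n, hmem e⟩, fun φ hφ => ?_⟩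
  obtain ⟨x, hx⟩ := hV
  have hsub : ∀ e ∈ H.edges, e.image φ ∩ range n = e.image φ := fun e he =>
    inter_eq_left.mpr (image_subset_iff.mpr fun v hv => hφ.2 v (hE e he hv))
  refine ⟨x, hx, fun e₁ h₁ e₂ h₂ h => eq_of_image_eq_of_isCopy hφ (hE e₁ h₁) (hE e₂ h₂) ?_⟩
  have h := congrArg Subtype.val ((range n).powerset.equivFin.injective h)
  simpa only [hsub e₁ h₁, hsub e₂ h₂] using h

theorem stmt_11 :
    ∃ c : ℝ, 0 < c ∧ ∃ n₀ : ℕ, ∀ n : ℕ, n₀ ≤ n →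
      c * (n : ℝ) ^ ((1 : ℝ) / 7) ≤ (localC n (SP2 4) : ℝ) := by
  refine ⟨(1 / 59 : ℝ) ^ ((1 : ℝ) / 7), by positivity, 0, fun n _ => ?_⟩
  have hne : {k | ∃ f : ℕ → Finset ℕ → Fin k, IsLocalColoring n k (SP2 4) f}.Nonempty :=
    exists_isLocalColoring_s11 n (by decide) (by decide)
  obtain ⟨f, hf⟩ := Nat.sInf_mem hne
  have hlt : (n : ℝ) < 59 * (localC n (SP2 4) : ℝ) ^ 7 := by
    exact_mod_cast hf.lt_of_SP2_four
  rw [← Real.mul_rpow (by norm_num) (Nat.cast_nonneg n)]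
  calc (1 / 59 * (n : ℝ)) ^ ((1 : ℝ) / 7)
      ≤ ((localC n (SP2 4) : ℝ) ^ 7) ^ ((1 : ℝ) / 7) :=
        Real.rpow_le_rpow (by positivity) (by linarith) (by norm_num)
    _ = localC n (SP2 4) := by
        rw [one_div]
        exact_mod_cast Real.pow_rpow_inv_natCast (Nat.cast_nonneg _) (n := 7) (by norm_num)
end

section
/- Let r ≥ 2 and let p be an integer with p ≥ (2r-1)r + 2(r-1). Then there exist a constant c > 0 and an n_0 such that for all n ≥ n_0, C_r(n, K_p^{(r)}) ≥ c · n^{r/(r+1)}, where K_p^{(r)} is the complete r-uniform hypergraph on p vertices. -/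
open Finset

/-- The complete `r`-uniform hypergraph on `p` vertices. -/
def completeH (r p : ℕ) : HGraph :=
  ⟨Finset.Icc 1 p, (Finset.Icc 1 p).powersetCard r⟩

/-- At most `k` elements are alone in their class of a colouring with `k` colours. -/
lemma card_alone_le {α : Type*} [DecidableEq α] {k : ℕ} (s : Finset α) (c : α → Fin k) :
    (s.filter fun x => ∀ y ∈ s, c y = c x → y = x).card ≤ k := by
  have h := Finset.card_le_card_of_injOn (s := s.filter fun x => ∀ y ∈ s, c y = c x → y = x)
    (t := (Finset.univ : Finset (Fin k))) c (fun _ _ => Finset.mem_coe.2 (Finset.mem_univ _))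
    (by
      intro x hx y hy hxy
      simp only [Finset.coe_filter, Set.mem_ofPred_eq] at hx hy
      exact hy.2 x hx.1 hxy)
  simpa using h

/-- The number of ordered pairs of distinct elements of equal colour is at least `|s| - k`. -/
lemma card_le_card_monochromatic_pairs_add {α : Type*} [DecidableEq α] {k : ℕ}
    (s : Finset α) (c : α → Fin k) :
    s.card ≤ (s.offDiag.filter fun q => c q.1 = c q.2).card + k := by
  have h₁ := Finset.card_filter_add_card_filter_not (s := s)
    (fun x => ∀ y ∈ s, c y = c x → y = x)
  have h₂ := card_alone_le s c
  have h₃ : (s.filter fun x => ¬ ∀ y ∈ s, c y = c x → y = x).card ≤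
      (s.offDiag.filter fun q => c q.1 = c q.2).card := by
    refine (Finset.card_le_card ?_).trans
      (Finset.card_image_le (f := Prod.fst) (s := s.offDiag.filter fun q => c q.1 = c q.2))
    intro x hx
    simp only [Finset.mem_filter, not_forall] at hx
    obtain ⟨hx, y, hy, hc, hne⟩ := hx
    refine Finset.mem_image.2 ⟨(x, y), ?_, rfl⟩
    simp only [Finset.mem_filter, Finset.mem_offDiag]
    exact ⟨⟨hx, hy, fun h => hne h.symm⟩, hc.symm⟩
  omega

/-- If `4 * k * w ≤ |V|` and every `v ∈ V` colours a set `I` of size `2 * k` with `k` colours, then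
two elements of `I` receive the same colour from at least `w` elements of `V`. -/
lemma exists_pair_le_card_filter {α β : Type*} [DecidableEq α] {k w : ℕ} (hk : 0 < k)
    (I : Finset α) (hI : I.card = 2 * k) (V : Finset β) (hV : 4 * k * w ≤ V.card)
    (c : β → α → Fin k) :
    ∃ i ∈ I, ∃ j ∈ I, i ≠ j ∧ w ≤ (V.filter fun v => c v i = c v j).card := by
  by_contra! H
  have hsum : V.card * k ≤ ∑ q ∈ I.offDiag, (V.filter fun v => c v q.1 = c v q.2).card := by
    have := Finset.sum_card_bipartiteAbove_eq_sum_card_bipartiteBelow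
      (s := I.offDiag) (t := V) (fun q v => c v q.1 = c v q.2)
    simp only [Finset.bipartiteAbove, Finset.bipartiteBelow] at this
    rw [this, ← smul_eq_mul]
    refine Finset.card_nsmul_le_sum _ _ _ fun v _ => ?_
    have := card_le_card_monochromatic_pairs_add I (c v)
    omega
  have hcard : I.offDiag.card < 4 * k * k := by
    rw [Finset.offDiag_card, hI]
    have : 0 < 4 * k * k := by positivity
    have e : 2 * k * (2 * k) = 4 * k * k := by ring
    rw [e]
    omega
  rcases Nat.eq_zero_or_pos w with rfl | hw
  · obtain ⟨i, hi, j, hj, hij⟩ := Finset.one_lt_card.1 (show 1 < I.card by omega)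
    exact absurd (H i hi j hj hij) (Nat.not_lt_zero _)
  have hle : ∑ q ∈ I.offDiag, (V.filter fun v => c v q.1 = c v q.2).card ≤
      I.offDiag.card * w := by
    rw [← smul_eq_mul]
    refine Finset.sum_le_card_nsmul _ _ _ fun q hq => ?_
    rw [Finset.mem_offDiag] at hq
    exact (H q.1 hq.1 q.2 hq.2.1 hq.2.2).le
  have h₁ : I.offDiag.card * w < 4 * k * k * w := Nat.mul_lt_mul_of_pos_right hcard hw
  have h₂ : 4 * k * w * k ≤ V.card * k := Nat.mul_le_mul_right k hV
  have h₃ : 4 * k * k * w = 4 * k * w * k := by ring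
  omega

/-- If a set `B` of colourings of `E` with `k` colours satisfies `|B| * k < |E|`, then some
element of `E` shares its colour with another element in each of them. -/
lemma exists_common_twin {α β : Type*} [DecidableEq α] [DecidableEq β] {k : ℕ} (B : Finset β)
    (E : Finset α) (h : B.card * k < E.card) (c : β → α → Fin k) :
    ∃ g ∈ E, ∀ b ∈ B, ∃ g' ∈ E, c b g' = c b g ∧ g' ≠ g := by
  by_contra! H
  have hsub : E ⊆ B.biUnion fun b => E.filter fun x => ∀ y ∈ E, c b y = c b x → y = x := by
    intro g hg
    obtain ⟨b, hb, hb'⟩ := H g hg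
    exact Finset.mem_biUnion.2 ⟨b, hb, Finset.mem_filter.2 ⟨hg, hb'⟩⟩
  have := (Finset.card_le_card hsub).trans
    (Finset.card_biUnion_le_card_mul _ _ k fun b _ => card_alone_le E (c b))
  omega

/-- A local colouring for `completeH r p` has, in every `p`-subset of `range n`, a vertex whose
colouring is injective on the `r`-subsets. -/
lemma IsLocalColoring.exists_injOn {n k r p : ℕ} {f : ℕ → Finset ℕ → Fin k}
    (hf : IsLocalColoring n k (completeH r p) f) {S : Finset ℕ} (hS : S ⊆ Finset.range n)
    (hcard : S.card = p) :
    ∃ u ∈ S, ∀ e₁ ∈ S.powersetCard r, ∀ e₂ ∈ S.powersetCard r, f u e₁ = f u e₂ → e₁ = e₂ := by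
  classical
  have hc : (Finset.Icc 1 p).card = S.card := by simp [hcard]
  let e := Finset.equivOfCardEq hc
  let φ : ℕ → ℕ := fun x => if h : x ∈ Finset.Icc 1 p then e ⟨x, h⟩ else 0
  have hφ : ∀ x (h : x ∈ Finset.Icc 1 p), φ x = e ⟨x, h⟩ := fun x h => dif_pos h
  have hmem : ∀ x ∈ Finset.Icc 1 p, φ x ∈ S := fun x h => by rw [hφ x h]; exact (e ⟨x, h⟩).2
  have hinj : Set.InjOn φ (Finset.Icc 1 p : Finset ℕ) := by
    intro x hx y hy hxy
    rw [hφ x hx, hφ y hy] at hxy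
    simpa using e.injective (Subtype.ext hxy)
  have hsurj : ∀ y ∈ S, ∃ x ∈ Finset.Icc 1 p, φ x = y := by
    intro y hy
    refine ⟨e.symm ⟨y, hy⟩, (e.symm ⟨y, hy⟩).2, ?_⟩
    rw [hφ _ (e.symm ⟨y, hy⟩).2]
    simp
  obtain ⟨x, hx, hrain⟩ := hf φ ⟨hinj, fun v hv => hS (hmem v hv)⟩
  have hpre : ∀ a ∈ S.powersetCard r, ∃ a' ∈ (Finset.Icc 1 p).powersetCard r, a'.image φ = a := by
    intro a ha
    rw [Finset.mem_powersetCard] at ha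
    have him : ((Finset.Icc 1 p).filter fun x => φ x ∈ a).image φ = a := by
      ext y
      simp only [Finset.mem_image, Finset.mem_filter]
      constructor
      · rintro ⟨x, ⟨_, h⟩, rfl⟩
        exact h
      · intro hy
        obtain ⟨x, hx, rfl⟩ := hsurj y (ha.1 hy)
        exact ⟨x, ⟨hx, hy⟩, rfl⟩
    refine ⟨_, Finset.mem_powersetCard.2 ⟨Finset.filter_subset _ _, ?_⟩, him⟩
    rw [← ha.2, ← Finset.card_image_of_injOn (f := φ)
      (hinj.mono (Finset.coe_subset.2 (Finset.filter_subset _ _))), him]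
  refine ⟨φ x, hmem x hx, fun e₁ h₁ e₂ h₂ h => ?_⟩
  obtain ⟨a₁, ha₁, rfl⟩ := hpre e₁ h₁
  obtain ⟨a₂, ha₂, rfl⟩ := hpre e₂ h₂
  rw [hrain a₁ ha₁ a₂ ha₂ h]

/-- There is no local colouring with `k` colours as soon as `n` is at least about `4 * k * w`, where
`w ≥ p` satisfies `r * k < w.choose r`. -/
lemma not_isLocalColoring {n k r p w : ℕ} (hr : 2 ≤ r)
    (hp : (2 * r - 1) * r + 2 * (r - 1) ≤ p) (f : ℕ → Finset ℕ → Fin k)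
    (hn : 4 * k * w + (r - 2 + 2 * k) ≤ n) (hw : r * k < w.choose r) (hpw : p ≤ w) :
    ¬ IsLocalColoring n k (completeH r p) f := by
  intro hf
  have hk : 0 < k := (Nat.zero_le _).trans_lt (f 0 ∅).isLt
  set F := Finset.range (r - 2) with hF
  set I := Finset.Ico (r - 2) (r - 2 + 2 * k) with hI
  set V := Finset.Ico (r - 2 + 2 * k) n with hV
  obtain ⟨i, hi, j, hj, hij, hW⟩ := exists_pair_le_card_filter (w := w) hk I (by simp [hI]) V
    (by simp only [hV, Nat.card_Ico]; omega) (fun v i => f v (insert v (insert i F)))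
  set W := V.filter fun v => f v (insert v (insert i F)) = f v (insert v (insert j F)) with hWdef
  set B := insert i (insert j F) with hB
  have hiF : i ∉ F := by simp only [hI, hF, Finset.mem_Ico, Finset.mem_range] at *; omega
  have hjF : j ∉ F := by simp only [hI, hF, Finset.mem_Ico, Finset.mem_range] at *; omega
  have hBcard : B.card = r := by
    rw [hB, Finset.card_insert_of_notMem (by simp [hij, hiF]),
      Finset.card_insert_of_notMem hjF, hF, Finset.card_range]
    omega
  have hBlt : ∀ b ∈ B, b < r - 2 + 2 * k := by
    intro b hb
    simp only [hB, hF, hI, Finset.mem_insert, Finset.mem_range, Finset.mem_Ico] at hb hi hj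
    omega
  have hWge : ∀ v ∈ W, r - 2 + 2 * k ≤ v ∧ v < n := by
    intro v hv
    simpa [hV] using (Finset.mem_filter.1 hv).1
  obtain ⟨g, hg, htwin⟩ := exists_common_twin B (W.powersetCard r)
    (by rw [hBcard, Finset.card_powersetCard]; exact hw.trans_le (Nat.choose_le_choose r hW)) f
  choose! t ht using htwin
  set S₀ := B ∪ g ∪ B.biUnion t with hS₀
  have hgW := Finset.mem_powersetCard.1 hg
  have htW := fun b hb => Finset.mem_powersetCard.1 (ht b hb).1
  have hsub : S₀ ⊆ B ∪ W := by
    refine Finset.union_subset (Finset.union_subset_union subset_rfl hgW.1)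
      (Finset.biUnion_subset.2 fun b hb => (htW b hb).1.trans Finset.subset_union_right)
  have hcard : S₀.card ≤ p := by
    have h₁ : S₀.card ≤ r + r + r * r := by
      refine (Finset.card_union_le _ _).trans (Nat.add_le_add ?_ ?_)
      · refine (Finset.card_union_le _ _).trans (by rw [hBcard, hgW.2])
      · refine (Finset.card_biUnion_le_card_mul _ _ r fun b hb => (htW b hb).2.le).trans ?_
        rw [hBcard]
    obtain ⟨s, rfl⟩ := Nat.exists_eq_add_of_le hr
    have e₁ : 2 * (2 + s) - 1 = 2 * s + 3 := by omega
    have e₂ : 2 * (2 + s - 1) = 2 * s + 2 := by omega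
    rw [e₁, e₂] at hp
    nlinarith
  obtain ⟨S, hS₀S, hSsub, hScard⟩ := Finset.exists_subsuperset_card_eq hsub hcard
    (hpw.trans (hW.trans (Finset.card_le_card Finset.subset_union_right)))
  have hSn : S ⊆ Finset.range n := by
    intro x hx
    rw [Finset.mem_range]
    rcases Finset.mem_union.1 (hSsub hx) with h | h
    · have := hBlt x h
      omega
    · exact (hWge x h).2
  obtain ⟨u, hu, hrain⟩ := hf.exists_injOn hSn hScard
  have hBS : B ⊆ S := (Finset.subset_union_left.trans Finset.subset_union_left).trans hS₀S
  rcases Finset.mem_union.1 (hSsub hu) with hub | huw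
  · refine (ht u hub).2.2 (hrain _ ?_ _ ?_ (ht u hub).2.1)
    · refine Finset.mem_powersetCard.2 ⟨?_, (htW u hub).2⟩
      exact ((Finset.subset_biUnion_of_mem t hub).trans Finset.subset_union_right).trans hS₀S
    · refine Finset.mem_powersetCard.2 ⟨?_, hgW.2⟩
      exact (Finset.subset_union_right.trans Finset.subset_union_left).trans hS₀S
  · have huB : u ∉ B := fun h => absurd (hBlt u h) (not_lt.2 (hWge u huw).1)
    have hedge : ∀ l ∈ B, l ∉ F → insert u (insert l F) ∈ S.powersetCard r := by
      intro l hl hlF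
      have hlB : insert l F ⊆ B := Finset.insert_subset hl
        ((Finset.subset_insert _ _).trans (Finset.subset_insert _ _))
      refine Finset.mem_powersetCard.2 ⟨Finset.insert_subset hu (hlB.trans hBS), ?_⟩
      rw [Finset.card_insert_of_notMem fun h => huB (hlB h), Finset.card_insert_of_notMem hlF, hF,
        Finset.card_range]
      omega
    have hiB : i ∈ B := by simp [hB]
    have hjB : j ∈ B := by simp [hB]
    have heq := hrain _ (hedge i hiB hiF) _ (hedge j hjB hjF) (Finset.mem_filter.1 huw).2
    have : i ∈ insert u (insert j F) := heq ▸ by simp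
    rcases Finset.mem_insert.1 this with rfl | h
    · exact huB hiB
    · rcases Finset.mem_insert.1 h with rfl | h
      · exact hij rfl
      · exact hiF h

lemma exists_isLocalColoring_s13 (n r p : ℕ) (hp : 1 ≤ p) :
    ∃ k, ∃ f : ℕ → Finset ℕ → Fin k, IsLocalColoring n k (completeH r p) f := by
  classical
  set K := (Finset.range n).powerset.sup Encodable.encode with hK
  refine ⟨K + 1, fun _ e => Fin.ofNat (K + 1) (Encodable.encode e), fun φ hφ => ?_⟩
  refine ⟨1, by simp [completeH, hp], fun e₁ h₁ e₂ h₂ h => ?_⟩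
  have hlt : ∀ e ∈ (completeH r p).edges, Encodable.encode (e.image φ) < K + 1 := by
    intro e he
    refine Nat.lt_succ_of_le (Finset.le_sup (f := Encodable.encode) (Finset.mem_powerset.2 ?_))
    exact Finset.image_subset_iff.2 fun x hx => hφ.2 x ((Finset.mem_powersetCard.1 he).1 hx)
  have h' := congrArg Fin.val h
  simp only [Fin.ofNat, Nat.mod_eq_of_lt (hlt e₁ h₁), Nat.mod_eq_of_lt (hlt e₂ h₂)] at h'
  have him := Encodable.encode_injective h'
  have hs : ∀ e ∈ (completeH r p).edges, (e : Set ℕ) ⊆ (completeH r p).verts := fun e he =>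
    Finset.coe_subset.2 (Finset.mem_powersetCard.1 he).1
  have him' : φ '' (e₁ : Set ℕ) = φ '' e₂ := by
    rw [← Finset.coe_image, ← Finset.coe_image, him]
  exact Finset.coe_injective ((hφ.1.image_eq_image_iff (hs _ h₁) (hs _ h₂)).1 him')

theorem stmt_13 (r p : ℕ) (hr : 2 ≤ r) (hp : (2 * r - 1) * r + 2 * (r - 1) ≤ p) :
    ∃ c : ℝ, 0 < c ∧ ∃ n₀ : ℕ, ∀ n : ℕ, n₀ ≤ n →
      c * (n : ℝ) ^ ((r : ℝ) / ((r : ℝ) + 1)) ≤ (localC n (completeH r p) : ℝ) := by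
  have hrR : (2 : ℝ) ≤ r := by exact_mod_cast hr
  refine ⟨1 / (16 * r), by positivity, (p + 4 * r) ^ (r + 1), fun n hn => ?_⟩
  by_contra! hlt
  have hmem : ∃ f : ℕ → Finset ℕ → Fin (localC n (completeH r p)),
      IsLocalColoring n (localC n (completeH r p)) (completeH r p) f :=
    Nat.sInf_mem (exists_isLocalColoring_s13 n r p (by omega))
  generalize localC n (completeH r p) = k at hmem hlt
  obtain ⟨f, hf⟩ := hmem
  set x : ℝ := (n : ℝ) ^ (1 / ((r : ℝ) + 1)) with hx
  have hx0 : 0 ≤ x := by positivity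
  have hxr : (n : ℝ) ^ ((r : ℝ) / ((r : ℝ) + 1)) = x ^ r := by
    rw [hx, ← Real.rpow_natCast, ← Real.rpow_mul (Nat.cast_nonneg n)]
    congr 1
    ring
  have hxn : x ^ (r + 1) = n := by
    rw [hx, ← Real.rpow_natCast, ← Real.rpow_mul (Nat.cast_nonneg n)]
    have : 1 / ((r : ℝ) + 1) * ((r + 1 : ℕ) : ℝ) = 1 := by
      push_cast
      field_simp
    rw [this, Real.rpow_one]
  have hxp : (p : ℝ) + 4 * r ≤ x := by
    refine le_of_pow_le_pow_left₀ (Nat.succ_ne_zero r) hx0 ?_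
    rw [Nat.succ_eq_add_one, hxn]
    exact_mod_cast hn
  have hp0 : (0 : ℝ) ≤ p := Nat.cast_nonneg p
  have hx1 : 1 ≤ x := by linarith
  rw [hxr] at hlt
  have hkx : 16 * r * (k : ℝ) < x ^ r := by
    have h := mul_lt_mul_of_pos_left hlt (show (0 : ℝ) < 16 * r by positivity)
    rwa [← mul_assoc, mul_one_div_cancel (by positivity), one_mul] at h
  set w := r + ⌈r * x⌉₊ with hwdef
  have hceil : r * x ≤ ⌈r * x⌉₊ := Nat.le_ceil _
  have hceil' : (⌈r * x⌉₊ : ℝ) < r * x + 1 := Nat.ceil_lt_add_one (by positivity)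
  have hwcast : (w : ℝ) = r + ⌈r * x⌉₊ := by rw [hwdef]; push_cast; rfl
  have hk0 : (0 : ℝ) ≤ k := Nat.cast_nonneg k
  have hxle : x ≤ n := by
    rw [← hxn]
    exact le_self_pow₀ hx1 (Nat.succ_ne_zero r)
  have hxrle : x ^ r ≤ n := by
    rw [← hxn]
    exact pow_le_pow_right₀ hx1 (Nat.le_succ r)
  refine not_isLocalColoring (w := w) hr hp f ?_ ?_ ?_ hf
  · have h₁ : (4 : ℝ) * k * w ≤ n / 2 := by
      have h₂ : (w : ℝ) ≤ 2 * (r * x) := by nlinarith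
      have h₃ : (4 : ℝ) * k * w ≤ 4 * k * (2 * (r * x)) := by gcongr
      have h₄ : 16 * r * (k : ℝ) * x ≤ x ^ r * x := by gcongr
      rw [← pow_succ, hxn] at h₄
      linarith
    have h₂ : (2 : ℝ) * k ≤ n / 16 := by nlinarith
    have h₃ : (4 * k * w + (r + 2 * k) : ℝ) ≤ n := by linarith
    have h₄ : 4 * k * w + (r + 2 * k) ≤ n := by exact_mod_cast h₃
    omega
  · have h₁ : x ^ r ≤ w.choose r := by
      refine le_trans ?_ (Nat.pow_le_choose r w)
      rw [le_div_iff₀ (by positivity)]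
      have h₂ : (r.factorial : ℝ) ≤ (r : ℝ) ^ r := by exact_mod_cast Nat.factorial_le_pow r
      have h₃ : r * x ≤ ((w + 1 - r : ℕ) : ℝ) :=
        hceil.trans (by exact_mod_cast (show ⌈r * x⌉₊ ≤ w + 1 - r by omega))
      calc x ^ r * r.factorial ≤ x ^ r * (r : ℝ) ^ r := by gcongr
        _ = (r * x) ^ r := by rw [mul_pow]; ring
        _ ≤ _ := by gcongr
    have h₃ : (r * k : ℝ) < w.choose r := by nlinarith
    exact_mod_cast h₃
  · have : (p : ℝ) ≤ w := by nlinarith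
    exact_mod_cast this
end
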